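/- For every ε ∈ (0, 1) there is a constant C = C(ε) ≥ 1 such that the following holds. Let F be a finite field with q elements, n ≥ 1, let k ≥ 1 be a real parameter, and suppose A ⊆ 𝔽_q^n has |A| ≥ 2^{−d}·q^n for some real d ≥ 1. Then there is a nonempty subset A′ ⊆ A such that: (i) |A′| · q^n ≥ |A| · |Span*(A′)|; (ii) the codimension of Span*(A′) is at most C · d^5 · k^4; and (iii) the k-norm divergence of the distribution r_{A′} from the uniform distribution on the affine subspace Span*(A′) + Span*(A′) is at most ε. -/

import Mathlib

open Pointwise

/-- The uniform distribution on a set `S`: `1_S / |S|`. -/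
noncomputable def uniformOn {Ω : Type*} (S : Set Ω) : Ω → ℝ :=
  fun x => S.indicator 1 x / (S.ncard : ℝ)

/-- The `k`-norm divergence of `π` from `π'` on a finite set `Ω`. -/
noncomputable def kNormDivergence {Ω : Type*} [Fintype Ω] (k : ℝ) (π π' : Ω → ℝ) : ℝ :=
  ((∑ x, |π x - π' x| ^ k) / (∑ x, π' x ^ k)) ^ (1/k)

/-- The representation-counting distribution `r_{A'}(x) = R_{A'}(x)/|A'|²`. -/
noncomputable def repDist {G : Type*} [AddCommGroup G] [DecidableEq G] (A' : Finset G) :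
    G → ℝ :=
  fun x => (((A' ×ˢ A').filter fun p => p.1 + p.2 = x).card : ℝ) / ((A'.card : ℝ) ^ 2)

section Sumsets

open Finset

section Moments

variable {G : Type*} [AddCommGroup G] [Fintype G]

/-- Unnormalised self-correlation. -/
def selfCorr (f : G → ℝ) (x : G) : ℝ := ∑ y, f y * f (y + x)

/-- Unnormalised self-convolution. -/
def selfConv (f : G → ℝ) (x : G) : ℝ := ∑ y, f y * f (x - y)

theorem card_mul_sum_selfCorr_pow (f : G → ℝ) (j : ℕ) :
    (Fintype.card G : ℝ) * ∑ z, selfCorr f z ^ j =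
      ∑ a : Fin j → G, (∑ x, ∏ i, f (a i + x)) ^ 2 := by
  have h1 : ∀ w z : G, selfCorr f z ^ j =
      ∑ a : Fin j → G, (∏ i, f (a i + w)) * ∏ i, f (a i + (w + z)) := by
    intro w z
    rw [selfCorr, Fintype.sum_pow]
    simp only [Finset.prod_mul_distrib]
    rw [← Equiv.sum_comp (Equiv.addRight (fun _ : Fin j => w))]
    simp [add_assoc]
  calc (Fintype.card G : ℝ) * ∑ z, selfCorr f z ^ j
      = ∑ w : G, ∑ z, selfCorr f z ^ j := by simp
    _ = ∑ w : G, ∑ z, ∑ a : Fin j → G, (∏ i, f (a i + w)) * ∏ i, f (a i + (w + z)) := by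
        refine Finset.sum_congr rfl fun w _ => Finset.sum_congr rfl fun z _ => h1 w z
    _ = ∑ a : Fin j → G, ∑ w : G, ∑ z, (∏ i, f (a i + w)) * ∏ i, f (a i + (w + z)) := by
        simp_rw [Finset.sum_comm (s := (univ : Finset G)) (t := (univ : Finset (Fin j → G)))]
    _ = _ := by
        refine Finset.sum_congr rfl fun a _ => ?_
        rw [sq, Finset.sum_mul_sum]
        refine Finset.sum_congr rfl fun w _ => ?_
        exact Equiv.sum_comp (Equiv.addLeft w) (fun z => (∏ i, f (a i + w)) * ∏ i, f (a i + z))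

theorem sum_selfCorr_pow_nonneg (f : G → ℝ) (j : ℕ) : 0 ≤ ∑ z, selfCorr f z ^ j := by
  have h := card_mul_sum_selfCorr_pow f j
  have hN : (0 : ℝ) < Fintype.card G := by exact_mod_cast Fintype.card_pos
  have h2 : 0 ≤ (Fintype.card G : ℝ) * ∑ z, selfCorr f z ^ j := by
    rw [h]; positivity
  exact nonneg_of_mul_nonneg_right h2 hN

theorem card_mul_sum_selfConv_pow (f : G → ℝ) (j : ℕ) :
    (Fintype.card G : ℝ) * ∑ z, selfConv f z ^ j =
      ∑ a : Fin j → G, (∑ x, ∏ i, f (a i + x)) * ∑ x, ∏ i, f (-a i + x) := by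
  have h1 : ∀ w z : G, selfConv f z ^ j =
      ∑ a : Fin j → G, (∏ i, f (a i + w)) * ∏ i, f (-a i + (z - w)) := by
    intro w z
    rw [selfConv, Fintype.sum_pow]
    simp only [Finset.prod_mul_distrib]
    rw [← Equiv.sum_comp (Equiv.addRight (fun _ : Fin j => w))]
    refine Finset.sum_congr rfl fun a _ => ?_
    congr 1
    refine Finset.prod_congr rfl fun i _ => ?_
    congr 1
    simp only [Equiv.coe_addRight, Pi.add_apply]
    abel
  calc (Fintype.card G : ℝ) * ∑ z, selfConv f z ^ j
      = ∑ w : G, ∑ z, selfConv f z ^ j := by simp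
    _ = ∑ w : G, ∑ z, ∑ a : Fin j → G, (∏ i, f (a i + w)) * ∏ i, f (-a i + (z - w)) := by
        refine Finset.sum_congr rfl fun w _ => Finset.sum_congr rfl fun z _ => h1 w z
    _ = ∑ a : Fin j → G, ∑ w : G, ∑ z, (∏ i, f (a i + w)) * ∏ i, f (-a i + (z - w)) := by
        simp_rw [Finset.sum_comm (s := (univ : Finset G)) (t := (univ : Finset (Fin j → G)))]
    _ = _ := by
        refine Finset.sum_congr rfl fun a _ => ?_
        rw [Finset.sum_mul_sum]
        refine Finset.sum_congr rfl fun w _ => ?_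
        exact Equiv.sum_comp (Equiv.subRight w) (fun z => (∏ i, f (a i + w)) * ∏ i, f (-a i + z))

theorem sum_selfConv_pow_le (f : G → ℝ) (j : ℕ) :
    ∑ z, selfConv f z ^ j ≤ ∑ z, selfCorr f z ^ j := by
  have hN : (0 : ℝ) < Fintype.card G := by exact_mod_cast Fintype.card_pos
  refine le_of_mul_le_mul_left ?_ hN
  rw [card_mul_sum_selfConv_pow, card_mul_sum_selfCorr_pow]
  have h : ∑ a : Fin j → G, (∑ x, ∏ i, f (-a i + x)) ^ 2
      = ∑ a : Fin j → G, (∑ x, ∏ i, f (a i + x)) ^ 2 :=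
    Equiv.sum_comp (Equiv.neg (Fin j → G)) (fun a => (∑ x, ∏ i, f (a i + x)) ^ 2)
  have h2 : ∑ a : Fin j → G, (∑ x, ∏ i, f (a i + x)) * ∑ x, ∏ i, f (-a i + x) ≤
      ∑ a : Fin j → G, ((∑ x, ∏ i, f (a i + x)) ^ 2 + (∑ x, ∏ i, f (-a i + x)) ^ 2) / 2 := by
    refine Finset.sum_le_sum fun a _ => ?_
    nlinarith [sq_nonneg ((∑ x, ∏ i, f (a i + x)) - ∑ x, ∏ i, f (-a i + x))]
  rw [← Finset.sum_div, Finset.sum_add_distrib, h] at h2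
  linarith

end Moments

section Unbalancing

variable {G : Type*} [Fintype G]

theorem one_add_div_mul_sub_le_pow {s : ℝ} (hs : 0 ≤ s) {K j : ℕ} (hK : 0 < K) (hj : K ≤ j) :
    1 + (j / K : ℝ) * (s ^ K - 1) ≤ s ^ j := by
  have h1 : (1 : ℝ) ≤ (j / K : ℝ) := by
    rw [le_div_iff₀ (by exact_mod_cast hK)]; simpa using (by exact_mod_cast hj : (K : ℝ) ≤ j)
  have h2 : -1 ≤ s ^ K - 1 := by have := pow_nonneg hs K; linarith
  have h3 := one_add_mul_self_le_rpow_one_add h2 h1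
  have h4 : (1 + (s ^ K - 1)) ^ (j / K : ℝ) = s ^ j := by
    rw [add_sub_cancel, ← Real.rpow_natCast s K, ← Real.rpow_mul hs, ← Real.rpow_natCast]
    congr 1
    field_simp
  linarith

/-- If all moments of `g` are nonnegative and an even moment is large, then `1 + g` has a large
high moment. -/
theorem le_sum_one_add_pow (g : G → ℝ) (hg : ∀ j : ℕ, 0 ≤ ∑ x, g x ^ j) {ε : ℝ} (hε : 0 < ε)
    (hε1 : ε ≤ 1) {K p : ℕ} (hK : 0 < K) (hKe : Even K)
    (hgK : ε ^ K * Fintype.card G ≤ ∑ x, g x ^ K)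
    (hp : (2 + 2 ^ (K + 1)) * (1 + ε / 2) ^ p ≤ (1 + ε) ^ p) :
    (1 + ε / 2) ^ p * Fintype.card G ≤ ∑ x, (1 + g x) ^ p := by
  set N : ℝ := ((Fintype.card G : ℕ) : ℝ) with hN
  have hN0 : 0 ≤ N := by positivity
  have heven : ∀ j : ℕ, Even j → K ≤ j → ε ^ j * N ≤ ∑ x, g x ^ j := by
    intro j hje hj
    have h1 : ∀ x, ε ^ j * (1 + (j / K : ℝ) * ((g x ^ K) / ε ^ K - 1)) ≤ g x ^ j := by
      intro x
      have := one_add_div_mul_sub_le_pow (s := |g x| / ε) (by positivity) hK hj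
      rw [div_pow, div_pow, hje.pow_abs, hKe.pow_abs, le_div_iff₀ (by positivity)] at this
      linarith
    have h2 := Finset.sum_le_sum fun x (_ : x ∈ (univ : Finset G)) => h1 x
    refine le_trans ?_ h2
    rw [← Finset.mul_sum, Finset.sum_add_distrib, ← Finset.mul_sum, Finset.sum_sub_distrib,
      ← Finset.sum_div]
    simp only [sum_const, card_univ, nsmul_eq_mul, mul_one]
    rw [← hN]
    refine mul_le_mul_of_nonneg_left ?_ (by positivity)
    have : N ≤ (∑ x, g x ^ K) / ε ^ K := by
      rw [le_div_iff₀ (by positivity)]; linarith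
    have h5 : 0 ≤ (j / K : ℝ) * ((∑ x, g x ^ K) / ε ^ K - N) :=
      mul_nonneg (by positivity) (by linarith)
    linarith
  have hlow : ∀ j : ℕ, N * ((ε ^ j + (-ε) ^ j) / 2 -
      2 ^ K * (((ε / 2) ^ j + (-(ε / 2)) ^ j) / 2)) ≤ ∑ x, g x ^ j := by
    intro j
    rcases Nat.even_or_odd j with hj | hj
    · rw [hj.neg_pow, hj.neg_pow]
      rcases le_or_gt K j with hKj | hKj
      · have := heven j hj hKj
        have h3 : 0 ≤ N * (2 ^ K * (ε / 2) ^ j) := by positivity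
        linarith
      · refine le_trans ?_ (hg j)
        refine mul_nonpos_of_nonneg_of_nonpos hN0 ?_
        have : (ε : ℝ) ^ j ≤ 2 ^ K * (ε / 2) ^ j := by
          rw [div_pow]
          have h4 : (2 : ℝ) ^ j ≤ 2 ^ K := pow_le_pow_right₀ (by norm_num) hKj.le
          rw [mul_div_assoc', le_div_iff₀ (by positivity)]
          have : 0 ≤ ε ^ j := by positivity
          nlinarith
        linarith
    · rw [hj.neg_pow, hj.neg_pow]
      refine le_trans ?_ (hg j)
      simp
  have hexp : ∀ y : ℝ, (1 + y) ^ p = ∑ j ∈ range (p + 1), y ^ j * (p.choose j : ℝ) := by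
    intro y
    rw [add_comm, add_pow]
    simp
  have h1 : ∑ x, (1 + g x) ^ p = ∑ j ∈ range (p + 1), (∑ x, g x ^ j) * (p.choose j : ℝ) := by
    simp_rw [hexp, Finset.sum_mul]
    exact Finset.sum_comm
  have h2 : N * (((1 + ε) ^ p + (1 + -ε) ^ p) / 2 -
      2 ^ K * (((1 + ε / 2) ^ p + (1 + -(ε / 2)) ^ p) / 2)) ≤ ∑ x, (1 + g x) ^ p := by
    rw [h1, hexp, hexp, hexp, hexp, ← Finset.sum_add_distrib, ← Finset.sum_add_distrib,
      Finset.sum_div, Finset.sum_div, Finset.mul_sum, ← Finset.sum_sub_distrib, Finset.mul_sum]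
    refine Finset.sum_le_sum fun j _ => ?_
    refine le_trans (le_of_eq ?_) (mul_le_mul_of_nonneg_right (hlow j) (by positivity))
    ring
  refine le_trans ?_ h2
  rw [mul_comm]
  refine mul_le_mul_of_nonneg_left ?_ hN0
  have h3 : 0 ≤ (1 + -ε) ^ p := pow_nonneg (by linarith) _
  have h4 : (1 + -(ε / 2)) ^ p ≤ (1 + ε / 2) ^ p :=
    pow_le_pow_left₀ (by linarith) (by linarith) _
  have h5 : (2 : ℝ) ^ K * (1 + -(ε / 2)) ^ p ≤ 2 ^ K * (1 + ε / 2) ^ p :=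
    mul_le_mul_of_nonneg_left h4 (by positivity)
  rw [pow_succ] at hp
  nlinarith

end Unbalancing

section Sifting

variable {G : Type*}

/-- Real-valued indicator function of a finite set. -/
noncomputable def ind (S : Finset G) (x : G) : ℝ := (S : Set G).indicator 1 x

theorem ind_of_mem {S : Finset G} {x : G} (h : x ∈ S) : ind S x = 1 := by simp [ind, h]

theorem ind_of_notMem {S : Finset G} {x : G} (h : x ∉ S) : ind S x = 0 := by simp [ind, h]

theorem ind_nonneg (S : Finset G) (x : G) : 0 ≤ ind S x := by
  by_cases h : x ∈ S <;> simp [ind, h]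

theorem ind_le_one (S : Finset G) (x : G) : ind S x ≤ 1 := by
  by_cases h : x ∈ S <;> simp [ind, h]

theorem sum_ind_mul [Fintype G] (S : Finset G) (f : G → ℝ) : ∑ x, ind S x * f x = ∑ x ∈ S, f x := by
  classical
  rw [← Finset.sum_subset (Finset.subset_univ S)]
  · exact Finset.sum_congr rfl fun x hx => by rw [ind_of_mem hx, one_mul]
  · intro x _ hx
    rw [ind_of_notMem hx, zero_mul]

theorem sum_ind [Fintype G] (S : Finset G) : ∑ x, ind S x = #S := by
  simpa using sum_ind_mul S (fun _ => 1)

variable [AddCommGroup G]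

/-- The average of `f` over the translates by `u` of the differences of elements of `A`. -/
noncomputable def pairAvg (A : Finset G) (f : G → ℝ) (u : G) : ℝ :=
  (∑ a ∈ A, ∑ b ∈ A, f (b - a + u)) / (#A : ℝ) ^ 2

variable [Fintype G]

theorem sum_selfCorr_ind_mul (A : Finset G) (f : G → ℝ) :
    ∑ x, selfCorr (ind A) x * f x = ∑ a ∈ A, ∑ b ∈ A, f (b - a) := by
  simp_rw [selfCorr, Finset.sum_mul]
  rw [Finset.sum_comm, ← sum_ind_mul A]
  refine Finset.sum_congr rfl fun y _ => ?_
  rw [← sum_ind_mul A, Finset.mul_sum,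
    ← Equiv.sum_comp (Equiv.addLeft y) (fun z => ind A y * (ind A z * f (z - y)))]
  refine Finset.sum_congr rfl fun z _ => ?_
  simp [mul_assoc]

theorem sum_selfCorr_ind (A : Finset G) : ∑ x, selfCorr (ind A) x = (#A : ℝ) ^ 2 := by
  have := sum_selfCorr_ind_mul A (fun _ => 1)
  simpa [sq] using this

theorem exists_sift (B S : Finset G) {p : ℕ} {M η : ℝ} (hM : 0 < M) (hη : 0 < η)
    (hlarge : M ≤ ∑ x, selfCorr (ind B) x ^ p)
    (hsmall : ∀ x ∉ S, selfCorr (ind B) x ^ p * Fintype.card G ≤ η / 2 * M) :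
    ∃ A : Finset G, A.Nonempty ∧ M * Fintype.card G ≤ 2 * (#A : ℝ) ^ 2 * (Fintype.card G : ℝ) ^ p ∧
      1 - η ≤ pairAvg A (ind S) 0 := by
  classical
  set N : ℝ := ((Fintype.card G : ℕ) : ℝ) with hN
  have hN0 : 0 < N := by rw [hN]; exact_mod_cast Fintype.card_pos
  let A : (Fin p → G) → Finset G := fun s => univ.filter fun a => ∀ i, a + s i ∈ B
  have hA : ∀ s a, ind (A s) a = ∏ i, ind B (a + s i) := by
    intro s a
    by_cases h : ∀ i, a + s i ∈ B
    · rw [ind_of_mem (by simpa [A] using h)]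
      exact (Finset.prod_eq_one fun i _ => ind_of_mem (h i)).symm
    · rw [ind_of_notMem (by simpa [A] using h)]
      push Not at h
      obtain ⟨i, hi⟩ := h
      exact (Finset.prod_eq_zero (f := fun i => ind B (a + s i)) (Finset.mem_univ i)
        (ind_of_notMem hi)).symm
  have hsum : ∀ x, ∑ s, selfCorr (ind (A s)) x = N * selfCorr (ind B) x ^ p := by
    intro x
    simp_rw [selfCorr, hA]
    rw [Finset.sum_comm]
    have : ∀ y : G, ∑ s : Fin p → G, (∏ i, ind B (y + s i)) * ∏ i, ind B (y + x + s i)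
        = (∑ z, ind B z * ind B (z + x)) ^ p := by
      intro y
      rw [← Equiv.sum_comp (Equiv.addLeft y), Fintype.sum_pow]
      refine Finset.sum_congr rfl fun s _ => ?_
      rw [← Finset.prod_mul_distrib]
      refine Finset.prod_congr rfl fun i _ => ?_
      simp only [Equiv.coe_addLeft]
      rw [add_right_comm]
    simp_rw [this]
    simp [hN]
  set R : ℝ := ∑ x, selfCorr (ind B) x ^ p
  have hbad : ∑ x, (selfCorr (ind B) x ^ p) * (1 - ind S x) ≤ η / 2 * M := by
    have h1 : ∀ x, (selfCorr (ind B) x ^ p) * (1 - ind S x) ≤ (η / 2 * M) / N := by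
      intro x
      by_cases hx : x ∈ S
      · rw [ind_of_mem hx]
        simp only [sub_self, mul_zero]
        positivity
      · rw [ind_of_notMem hx, le_div_iff₀ hN0]
        simpa using hsmall x hx
    refine (Finset.sum_le_sum fun x _ => h1 x).trans ?_
    simp only [sum_const, card_univ, nsmul_eq_mul]
    rw [← hN]
    exact le_of_eq (by field_simp)
  let bad : (Fin p → G) → ℝ := fun s => ∑ x, selfCorr (ind (A s)) x * (1 - ind S x)
  have hbadsum : ∑ s, bad s ≤ N * (η / 2 * M) := by
    simp only [bad]
    rw [Finset.sum_comm]
    simp_rw [← Finset.sum_mul, hsum, mul_assoc]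
    rw [← Finset.mul_sum]
    exact mul_le_mul_of_nonneg_left hbad hN0.le
  have hcard : ∑ s, (#(A s) : ℝ) ^ 2 = N * R := by
    simp_rw [← sum_selfCorr_ind]
    rw [Finset.sum_comm]
    simp_rw [hsum]
    rw [← Finset.mul_sum]
  have htot : ∑ s : Fin p → G, (N * (η / 2 * M) / N ^ p) ≤
      ∑ s, (η * (#(A s) : ℝ) ^ 2 - bad s) := by
    rw [Finset.sum_sub_distrib, ← Finset.mul_sum, hcard]
    simp only [sum_const, card_univ, Fintype.card_fun, Fintype.card_fin, nsmul_eq_mul]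
    push_cast
    rw [← hN, mul_div_cancel₀ _ (by positivity)]
    have : N * (η * M) ≤ N * (η * R) := by gcongr
    linarith
  obtain ⟨s, -, hs⟩ := Finset.exists_le_of_sum_le Finset.univ_nonempty htot
  have hbad0 : 0 ≤ bad s := by
    refine Finset.sum_nonneg fun x _ => mul_nonneg ?_ (by linarith [ind_le_one S x])
    exact Finset.sum_nonneg fun y _ => mul_nonneg (ind_nonneg _ _) (ind_nonneg _ _)
  have hpos : 0 < N * (η / 2 * M) / N ^ p := by positivity
  have hA0 : 0 < (#(A s) : ℝ) ^ 2 := by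
    by_contra h
    have : (#(A s) : ℝ) ^ 2 = 0 := le_antisymm (not_lt.mp h) (sq_nonneg _)
    rw [this] at hs
    linarith
  refine ⟨A s, ?_, ?_, ?_⟩
  · rw [← Finset.card_pos]
    have : (#(A s) : ℝ) ≠ 0 := fun h => by simp [h] at hA0
    exact Nat.pos_of_ne_zero (by exact_mod_cast this)
  · have h1 : N * (η / 2 * M) / N ^ p ≤ η * (#(A s) : ℝ) ^ 2 := by linarith
    rw [div_le_iff₀ (by positivity)] at h1
    have h2 : η * (M * N) ≤ η * (2 * (#(A s) : ℝ) ^ 2 * N ^ p) := by linarith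
    exact le_of_mul_le_mul_left h2 hη
  · have h1 : bad s = (#(A s) : ℝ) ^ 2 - ∑ x, selfCorr (ind (A s)) x * ind S x := by
      simp only [bad, mul_sub, mul_one, Finset.sum_sub_distrib, sum_selfCorr_ind]
    rw [pairAvg, le_div_iff₀ hA0]
    simp only [add_zero]
    rw [← sum_selfCorr_ind_mul]
    linarith

end Sifting

section AlmostPeriodicity

theorem sum_exp_le {α : Type*} (A : Finset α) (X : α → ℝ) (hX : ∀ a ∈ A, |X a| ≤ 1)
    (h0 : ∑ a ∈ A, X a = 0) (l : ℝ) :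
    ∑ a ∈ A, Real.exp (l * X a) ≤ #A * Real.exp (l ^ 2 / 2) := by
  have h1 : ∀ a ∈ A, Real.exp (l * X a) ≤ Real.cosh l + X a * Real.sinh l := by
    intro a ha
    have := Real.exp_mul_le_cosh_add_mul_sinh (hX a ha) l
    rwa [mul_comm] at this
  refine (Finset.sum_le_sum h1).trans ?_
  rw [Finset.sum_add_distrib, ← Finset.sum_mul, h0]
  simp only [sum_const, nsmul_eq_mul, zero_mul, add_zero]
  exact mul_le_mul_of_nonneg_left (Real.cosh_le_exp_half_sq l) (by positivity)

theorem card_large_deviation_le {α : Type*} (A : Finset α) (X : α → ℝ)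
    (hX : ∀ a ∈ A, |X a| ≤ 1) (h0 : ∑ a ∈ A, X a = 0) {δ : ℝ} (hδ : 0 < δ) (m : ℕ) :
    (#((Fintype.piFinset fun _ : Fin m => A).filter fun s => δ * m < |∑ i, X (s i)|) : ℝ) ≤
      2 * Real.exp (-(δ ^ 2 * m / 2)) * (#A : ℝ) ^ m := by
  have hexp : ∀ l : ℝ, ∑ s ∈ Fintype.piFinset (fun _ : Fin m => A), Real.exp (l * ∑ i, X (s i)) ≤
      (#A : ℝ) ^ m * Real.exp (l ^ 2 * m / 2) := by
    intro l
    simp_rw [Finset.mul_sum, Real.exp_sum]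
    rw [← Finset.sum_pow' A (fun a => Real.exp (l * X a)) m]
    refine (pow_le_pow_left₀ (by positivity) (sum_exp_le A X hX h0 l) m).trans ?_
    rw [mul_pow, ← Real.exp_nat_mul]
    refine le_of_eq ?_
    congr 2
    ring
  set D := (Fintype.piFinset fun _ : Fin m => A).filter fun s => δ * m < |∑ i, X (s i)|
  have h1 : ∀ s ∈ D, Real.exp (δ ^ 2 * m) ≤
      Real.exp (δ * ∑ i, X (s i)) + Real.exp (-δ * ∑ i, X (s i)) := by
    intro s hs
    have hs' : δ * m < |∑ i, X (s i)| := (Finset.mem_filter.mp hs).2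
    have hpos := Real.exp_pos (δ * ∑ i, X (s i))
    have hpos' := Real.exp_pos (-δ * ∑ i, X (s i))
    rcases lt_abs.mp hs' with h | h
    · have : Real.exp (δ ^ 2 * m) ≤ Real.exp (δ * ∑ i, X (s i)) := by
        apply Real.exp_le_exp.mpr; nlinarith
      linarith
    · have : Real.exp (δ ^ 2 * m) ≤ Real.exp (-δ * ∑ i, X (s i)) := by
        apply Real.exp_le_exp.mpr; nlinarith
      linarith
  have h2 : (#D : ℝ) * Real.exp (δ ^ 2 * m) ≤ 2 * ((#A : ℝ) ^ m * Real.exp (δ ^ 2 * m / 2)) := by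
    calc (#D : ℝ) * Real.exp (δ ^ 2 * m) = ∑ s ∈ D, Real.exp (δ ^ 2 * m) := by simp
      _ ≤ ∑ s ∈ D, (Real.exp (δ * ∑ i, X (s i)) + Real.exp (-δ * ∑ i, X (s i))) :=
          Finset.sum_le_sum h1
      _ ≤ ∑ s ∈ Fintype.piFinset (fun _ : Fin m => A),
            (Real.exp (δ * ∑ i, X (s i)) + Real.exp (-δ * ∑ i, X (s i))) :=
          Finset.sum_le_sum_of_subset_of_nonneg (Finset.filter_subset _ _)
            fun _ _ _ => by positivity
      _ ≤ _ := by
          rw [Finset.sum_add_distrib]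
          have := hexp δ
          have h' := hexp (-δ)
          rw [neg_sq] at h'
          linarith
  have h3 : Real.exp (δ ^ 2 * m) = Real.exp (δ ^ 2 * m / 2) * Real.exp (δ ^ 2 * m / 2) := by
    rw [← Real.exp_add]; congr 1; ring
  rw [Real.exp_neg]
  have hE := Real.exp_pos (δ ^ 2 * m / 2)
  rw [h3, ← mul_assoc, ← mul_assoc] at h2
  have h4 := le_of_mul_le_mul_right h2 hE
  rw [← le_div_iff₀ hE] at h4
  refine h4.trans (le_of_eq ?_)
  rw [div_eq_mul_inv]; ring

variable {G : Type*} [AddCommGroup G] [Fintype G]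

theorem exists_almost_periods (A : Finset G) (hA : A.Nonempty) (f : G → ℝ) (hf0 : ∀ x, 0 ≤ f x)
    (hf1 : ∀ x, f x ≤ 1) {δ : ℝ} (hδ : 0 < δ) {m : ℕ} (hm : 0 < m)
    (h : 4 * Real.exp (-(δ ^ 2 * m / 2)) * Fintype.card G ≤ δ * #A) :
    ∃ T : Finset G, Fintype.card G * (#A : ℝ) ^ m ≤ 2 * #T * (Fintype.card G : ℝ) ^ m ∧
      ∀ u, ∀ t ∈ T, ∀ t' ∈ T, |pairAvg A f (u + t) - pairAvg A f (u + t')| ≤ 4 * δ := by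
  classical
  set N : ℝ := ((Fintype.card G : ℕ) : ℝ) with hN
  have hN0 : 0 < N := by rw [hN]; exact_mod_cast Fintype.card_pos
  have hA0 : (0 : ℝ) < #A := by exact_mod_cast hA.card_pos
  have hm0 : (0 : ℝ) < m := by exact_mod_cast hm
  set E := Real.exp (-(δ ^ 2 * m / 2)) with hE
  have hE0 : 0 < E := Real.exp_pos _
  let g : G → ℝ := fun x => (∑ b ∈ A, f (b + x)) / #A
  have hg0 : ∀ x, 0 ≤ g x := fun x =>
    div_nonneg (Finset.sum_nonneg fun b _ => hf0 _) hA0.le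
  have hg1 : ∀ x, g x ≤ 1 := fun x => by
    rw [div_le_one hA0]
    refine (Finset.sum_le_sum fun b _ => hf1 (b + x)).trans (by simp)
  let bad : (Fin m → G) → Finset G := fun s =>
    univ.filter fun x => δ * m < |∑ i, (f (s i + x) - g x)|
  let P := Fintype.piFinset fun _ : Fin m => A
  have hPcard : (#P : ℝ) = (#A : ℝ) ^ m := by simp [P]
  have hbadsum : ∑ s ∈ P, (#(bad s) : ℝ) ≤ N * (2 * E * (#A : ℝ) ^ m) := by
    have h1 : ∑ s ∈ P, (#(bad s) : ℝ) =
        ∑ x : G, (#(P.filter fun s => δ * m < |∑ i, (f (s i + x) - g x)|) : ℝ) := by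
      have := Finset.sum_card_bipartiteAbove_eq_sum_card_bipartiteBelow
        (s := P) (t := (univ : Finset G))
        (fun s x => δ * m < |∑ i, (f (s i + x) - g x)|)
      exact_mod_cast this
    rw [h1]
    have h2 : ∀ x : G, (#(P.filter fun s => δ * m < |∑ i, (f (s i + x) - g x)|) : ℝ) ≤
        2 * E * (#A : ℝ) ^ m := by
      intro x
      refine card_large_deviation_le A (fun a => f (a + x) - g x) ?_ ?_ hδ m
      · intro a _
        rw [abs_le]
        constructor <;> linarith [hf0 (a + x), hf1 (a + x), hg0 x, hg1 x]
      · rw [Finset.sum_sub_distrib]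
        simp only [sum_const, nsmul_eq_mul, g]
        field_simp
        simp
    refine (Finset.sum_le_sum fun x _ => h2 x).trans (le_of_eq ?_)
    simp [hN]
  let good := P.filter fun s => (#(bad s) : ℝ) ≤ 4 * E * N
  have hgood : (#A : ℝ) ^ m ≤ 2 * #good := by
    have h1 : (#(P.filter fun s => ¬ (#(bad s) : ℝ) ≤ 4 * E * N) : ℝ) * (4 * E * N) ≤
        N * (2 * E * (#A : ℝ) ^ m) := by
      refine le_trans ?_ hbadsum
      rw [← nsmul_eq_mul]
      refine (Finset.card_nsmul_le_sum _ (fun s => (#(bad s) : ℝ)) _ ?_).trans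
        (Finset.sum_le_sum_of_subset_of_nonneg (Finset.filter_subset _ _)
          fun _ _ _ => by positivity)
      intro s hs
      exact (not_le.mp (Finset.mem_filter.mp hs).2).le
    have h2 : (#good : ℝ) + #(P.filter fun s => ¬ (#(bad s) : ℝ) ≤ 4 * E * N) = #P := by
      exact_mod_cast Finset.card_filter_add_card_filter_not (s := P)
        (fun s => (#(bad s) : ℝ) ≤ 4 * E * N)
    rw [hPcard] at h2
    have h3 : (2 * E * N) * (2 * (#(P.filter fun s => ¬ (#(bad s) : ℝ) ≤ 4 * E * N) : ℝ)) ≤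
        (2 * E * N) * (#A : ℝ) ^ m := by linarith
    have h4 := le_of_mul_le_mul_left h3 (by positivity)
    linarith
  let T : (Fin m → G) → Finset G := fun b => univ.filter fun t => (fun i => b i - t) ∈ good
  have hTsum : ∑ b : Fin m → G, (#(T b) : ℝ) = N * #good := by
    have h1 : ∀ b, (#(T b) : ℝ) = ∑ t : G, if (fun i => b i - t) ∈ good then (1 : ℝ) else 0 := by
      intro b; simp [T]
    simp_rw [h1]
    rw [Finset.sum_comm]
    have h2 : ∀ t : G, ∑ b : Fin m → G, (if (fun i => b i - t) ∈ good then (1 : ℝ) else 0) =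
        #good := by
      intro t
      have := Equiv.sum_comp (Equiv.subRight (fun _ : Fin m => t))
        (fun b => if b ∈ good then (1 : ℝ) else 0)
      rw [show (∑ b : Fin m → G, if b ∈ good then (1 : ℝ) else 0) = #good by simp] at this
      exact this
    simp_rw [h2]
    simp [hN]
  have htot : ∑ b : Fin m → G, (N * #good / N ^ m) ≤ ∑ b, (#(T b) : ℝ) := by
    rw [hTsum]
    simp only [sum_const, card_univ, Fintype.card_fun, Fintype.card_fin, nsmul_eq_mul]
    push_cast
    rw [← hN, mul_div_cancel₀ _ (by positivity)]
  obtain ⟨b, -, hb⟩ := Finset.exists_le_of_sum_le Finset.univ_nonempty htot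
  refine ⟨T b, ?_, ?_⟩
  · rw [div_le_iff₀ (by positivity)] at hb
    have : N * (#A : ℝ) ^ m ≤ N * (2 * #good) := mul_le_mul_of_nonneg_left hgood hN0.le
    linarith
  · let H : G → ℝ := fun u => (∑ a ∈ A, (∑ i, f (b i + (u - a))) / m) / #A
    have key : ∀ u, ∀ t ∈ T b, |pairAvg A f (u + t) - H u| ≤ 2 * δ := by
      intro u t ht
      have htg : (fun i => b i - t) ∈ good := by simpa [T] using ht
      have hcardbad : (#(bad fun i => b i - t) : ℝ) ≤ 4 * E * N := (Finset.mem_filter.mp htg).2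
      have h1 : pairAvg A f (u + t) = (∑ a ∈ A, g (u + t - a)) / #A := by
        rw [pairAvg]
        simp only [g]
        rw [← Finset.sum_div, div_div, sq]
        congr 1
        refine Finset.sum_congr rfl fun a _ => Finset.sum_congr rfl fun c _ => ?_
        congr 1; abel
      have h2 : ∀ x, |g x - (∑ i, f (b i - t + x)) / m| ≤
          δ + ind (bad fun i => b i - t) x := by
        intro x
        by_cases hx : x ∈ bad fun i => b i - t
        · rw [ind_of_mem hx]
          have h0 : 0 ≤ (∑ i, f (b i - t + x)) / m :=
            div_nonneg (Finset.sum_nonneg fun b _ => hf0 _) hm0.le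
          have h1 : (∑ i, f (b i - t + x)) / m ≤ 1 := by
            rw [div_le_one hm0]
            refine (Finset.sum_le_sum fun i _ => hf1 (b i - t + x)).trans (by simp)
          rw [abs_le]
          constructor <;> linarith [hg0 x, hg1 x]
        · rw [ind_of_notMem hx, add_zero]
          have : ¬ (δ * m < |∑ i, (f (b i - t + x) - g x)|) := by simpa [bad] using hx
          rw [not_lt, Finset.sum_sub_distrib] at this
          simp only [sum_const, card_univ, Fintype.card_fin, nsmul_eq_mul] at this
          rw [abs_sub_comm]
          have h3 : (∑ i, f (b i - t + x)) / m - g x = (∑ i, f (b i - t + x) - m * g x) / m := by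
            field_simp
          rw [h3, abs_div, abs_of_pos hm0, div_le_iff₀ hm0]
          exact this
      have h3 : pairAvg A f (u + t) - H u =
          (∑ a ∈ A, (g (u + t - a) - (∑ i, f (b i - t + (u + t - a))) / m)) / #A := by
        rw [h1, Finset.sum_sub_distrib, sub_div]
        simp only [H]
        have h5 : ∀ a i, b i - t + (u + t - a) = b i + (u - a) := fun a i => by abel
        simp_rw [h5]
      rw [h3, abs_div, abs_of_pos hA0, div_le_iff₀ hA0]
      refine (Finset.abs_sum_le_sum_abs _ _).trans ?_
      refine (Finset.sum_le_sum fun a _ => h2 (u + t - a)).trans ?_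
      rw [Finset.sum_add_distrib]
      have h4 : ∑ a ∈ A, ind (bad fun i => b i - t) (u + t - a) ≤ #(bad fun i => b i - t) := by
        rw [← sum_ind]
        rw [← Equiv.sum_comp (Equiv.subLeft (u + t))]
        exact Finset.sum_le_sum_of_subset_of_nonneg (Finset.subset_univ _)
          fun _ _ _ => ind_nonneg _ _
      simp only [sum_const, nsmul_eq_mul]
      linarith
    intro u t ht t' ht'
    have h1 := abs_le.mp (key u t ht)
    have h2 := abs_le.mp (key u t' ht')
    rw [abs_le]
    constructor <;> linarith [h1.1, h1.2, h2.1, h2.2]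

end AlmostPeriodicity

section LargeSpectrum

variable {F G : Type*} [Field F] [AddCommGroup G] [Module F G]

theorem surjective_pi_of_linearIndependent {ι : Type*} [Finite ι] {φ : ι → Module.Dual F G}
    (hφ : LinearIndependent F φ) : Function.Surjective (LinearMap.pi φ) := by
  classical
  have := Fintype.ofFinite ι
  rw [← LinearMap.range_eq_top]
  by_contra h
  obtain ⟨f, hf0, hf⟩ := Submodule.exists_le_ker_of_lt_top _ (lt_top_iff_ne_top.mpr h)
  apply hf0
  have hf' : ∀ y : ι → F, f y = ∑ i, y i * f (Pi.single i 1) := by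
    intro y
    conv_lhs => rw [← Finset.univ_sum_single y, map_sum]
    refine Finset.sum_congr rfl fun i _ => ?_
    rw [← smul_eq_mul, ← map_smul, ← Pi.single_smul, smul_eq_mul, mul_one]
  have h0 : ∀ i, f (Pi.single i 1) = 0 := by
    refine Fintype.linearIndependent_iff.mp hφ _ ?_
    ext x
    have h1 : f (LinearMap.pi φ x) = 0 := hf (LinearMap.mem_range_self _ x)
    rw [hf'] at h1
    simpa [mul_comm] using h1
  ext1 i
  ext
  simp [h0]

theorem card_mul_sum_comp {H : Type*} [AddCommGroup H] [Fintype G] [Fintype H]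
    (φ : G →+ H) (hφ : Function.Surjective φ) (f : H → ℝ) :
    Fintype.card H * ∑ x, f (φ x) = Fintype.card G * ∑ y, f y := by
  classical
  have hc : ∀ y, #{x | φ x = y} = #{x | φ x = 0} := fun y =>
    AddMonoidHom.card_fiber_eq_of_mem_range φ (hφ y) (hφ 0)
  have h1 : ∀ f : H → ℝ, ∑ x, f (φ x) = #{x | φ x = 0} * ∑ y, f y := by
    intro f
    rw [← Finset.sum_fiberwise (s := univ) (g := φ), Finset.mul_sum]
    refine Finset.sum_congr rfl fun y _ => ?_
    rw [← hc y, ← nsmul_eq_mul, ← Finset.sum_const]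
    refine Finset.sum_congr rfl fun x hx => ?_
    rw [(Finset.mem_filter.mp hx).2]
  have h2 := h1 fun _ => 1
  simp only [sum_const, card_univ, nsmul_eq_mul, mul_one] at h2
  rw [h1, h2]
  ring

variable [Fintype F] [Fintype G]

theorem card_le_of_linearIndependent_spectrum (χ : AddChar F ℂ) (hχ : χ ≠ 1) {T : Finset G}
    (hT : T.Nonempty) {ι : Type*} [Fintype ι] {φ : ι → Module.Dual F G}
    (hφ : LinearIndependent F φ) (hφT : ∀ i, (#T : ℝ) / 2 ≤ ‖∑ t ∈ T, χ (φ i t)‖) :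
    (Fintype.card ι : ℝ) ≤ 8 * Real.log (Fintype.card G / #T) := by
  classical
  choose c hc1 hc using fun i => Complex.exists_norm_eq_mul_self (∑ t ∈ T, χ (φ i t))
  let Z : ι → F → ℝ := fun i y => (c i * χ y).re
  have hZ1 : ∀ i y, |Z i y| ≤ 1 := by
    intro i y
    refine (Complex.abs_re_le_norm _).trans ?_
    rw [norm_mul, hc1, AddChar.norm_apply, one_mul]
  have hZ0 : ∀ i, ∑ y, Z i y = 0 := by
    intro i
    simp only [Z]
    rw [← Complex.re_sum, ← Finset.mul_sum, AddChar.sum_eq_zero_of_ne_one hχ]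
    simp
  have hZT : ∀ i, (#T : ℝ) / 2 ≤ ∑ t ∈ T, Z i (φ i t) := by
    intro i
    refine (hφT i).trans (le_of_eq ?_)
    simp only [Z]
    rw [← Complex.re_sum, ← Finset.mul_sum, ← hc, Complex.ofReal_re]
  set r : ℝ := ((Fintype.card ι : ℕ) : ℝ) with hr
  have hT0 : (0 : ℝ) < #T := by exact_mod_cast hT.card_pos
  have hN0 : (0 : ℝ) < Fintype.card G := by exact_mod_cast Fintype.card_pos
  have hq0 : (0 : ℝ) < Fintype.card F := by exact_mod_cast Fintype.card_pos
  have hupper : ∑ x : G, Real.exp (∑ i, 1 / 2 * Z i (φ i x)) ≤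
      Fintype.card G * Real.exp (r / 8) := by
    have h1 := card_mul_sum_comp (LinearMap.pi φ).toAddMonoidHom
      (surjective_pi_of_linearIndependent hφ) fun y => Real.exp (∑ i, 1 / 2 * Z i (y i))
    have h2 : ∑ y : ι → F, Real.exp (∑ i, 1 / 2 * Z i (y i)) ≤
        (Fintype.card F : ℝ) ^ (Fintype.card ι) * Real.exp (r / 8) := by
      simp_rw [Real.exp_sum]
      rw [← Fintype.prod_sum fun i y => Real.exp (1 / 2 * Z i y)]
      refine (Finset.prod_le_prod (fun i _ => by positivity) fun i _ =>
        sum_exp_le univ (Z i) (fun y _ => hZ1 i y) (hZ0 i) (1 / 2)).trans (le_of_eq ?_)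
      rw [Finset.prod_const, card_univ, card_univ, mul_pow, ← Real.exp_nat_mul]
      congr 2
      rw [hr]; ring
    have h3 : (Fintype.card (ι → F) : ℝ) = (Fintype.card F : ℝ) ^ (Fintype.card ι) := by
      simp
    rw [h3] at h1
    have hQ : (0 : ℝ) < (Fintype.card F : ℝ) ^ (Fintype.card ι) := by positivity
    refine le_of_mul_le_mul_left ?_ hQ
    refine (le_of_eq h1).trans ?_
    refine (mul_le_mul_of_nonneg_left h2 hN0.le).trans (le_of_eq ?_)
    ring
  have hlower : #T * Real.exp (r / 4) ≤ ∑ x : G, Real.exp (∑ i, 1 / 2 * Z i (φ i x)) := by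
    have h1 : ∀ x : G, Real.exp (r / 4) * (1 + (∑ i, 1 / 2 * Z i (φ i x) - r / 4)) ≤
        Real.exp (∑ i, 1 / 2 * Z i (φ i x)) := by
      intro x
      have h2 := Real.add_one_le_exp (∑ i, 1 / 2 * Z i (φ i x) - r / 4)
      calc _ ≤ Real.exp (r / 4) * Real.exp (∑ i, 1 / 2 * Z i (φ i x) - r / 4) := by
            gcongr; linarith
        _ = _ := by rw [← Real.exp_add]; congr 1; ring
    refine le_trans ?_ (Finset.sum_le_sum_of_subset_of_nonneg (Finset.subset_univ T)
      fun _ _ _ => by positivity)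
    refine le_trans ?_ (Finset.sum_le_sum fun x _ => h1 x)
    rw [← Finset.mul_sum, Finset.sum_add_distrib, Finset.sum_sub_distrib, Finset.sum_comm]
    simp_rw [← Finset.mul_sum]
    simp only [sum_const, nsmul_eq_mul, mul_one]
    have h3 : r * (#T / 2) ≤ ∑ i, ∑ t ∈ T, Z i (φ i t) := by
      refine le_trans (le_of_eq ?_) (Finset.sum_le_sum fun i _ => hZT i)
      simp [hr]
    rw [mul_comm (#T : ℝ)]
    refine mul_le_mul_of_nonneg_left ?_ (Real.exp_pos _).le
    linarith
  have h4 := hlower.trans hupper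
  have h5 : Real.exp (r / 4) = Real.exp (r / 8) * Real.exp (r / 8) := by
    rw [← Real.exp_add]; congr 1; ring
  rw [h5, ← mul_assoc] at h4
  have h6 := le_of_mul_le_mul_right h4 (Real.exp_pos _)
  have h7 : r / 8 ≤ Real.log (Fintype.card G / #T) := by
    rw [Real.le_log_iff_exp_le (by positivity), le_div_iff₀ hT0]
    linarith
  linarith

theorem exists_annihilator (χ : AddChar F ℂ) (hχ : χ ≠ 1) {T : Finset G} (hT : T.Nonempty) :
    ∃ V : Submodule F G,
      (Module.finrank F G : ℝ) ≤ Module.finrank F V + 8 * Real.log (Fintype.card G / #T) ∧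
      ∀ φ : Module.Dual F G, (#T : ℝ) / 2 ≤ ‖∑ t ∈ T, χ (φ t)‖ → ∀ v ∈ V, φ v = 0 := by
  classical
  let Γ : Set (Module.Dual F G) := {φ | (#T : ℝ) / 2 ≤ ‖∑ t ∈ T, χ (φ t)‖}
  obtain ⟨b, hbΓ, hspan, hli⟩ := exists_linearIndependent F Γ
  have hfin : Finite b := hli.finite
  have := Fintype.ofFinite b
  refine ⟨(Submodule.span F Γ).dualCoannihilator, ?_, ?_⟩
  · have h1 := Subspace.finrank_add_finrank_dualCoannihilator_eq (Submodule.span F Γ)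
    have h2 : Module.finrank F (Submodule.span F Γ) = Fintype.card b := by
      rw [← hspan]
      have := finrank_span_eq_card hli
      rwa [Subtype.range_coe] at this
    have h3 := card_le_of_linearIndependent_spectrum χ hχ hT hli fun i => hbΓ i.2
    rw [← h1, h2]
    push_cast
    linarith
  · intro φ hφ v hv
    exact (Submodule.mem_dualCoannihilator v).mp hv φ (Submodule.subset_span hφ)

end LargeSpectrum

section Averages

variable {G : Type*} [AddCommGroup G]

/-- The average of `f` over the translate of `S` by `u`. -/
noncomputable def transAvg (S : Finset G) (f : G → ℝ) (u : G) : ℝ := (∑ v ∈ S, f (u + v)) / #S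

theorem pairAvg_le {T : Finset G} (hT : T.Nonempty) {f : G → ℝ} {c : ℝ} (hf : ∀ x, f x ≤ c)
    (u : G) : pairAvg T f u ≤ c := by
  have hT0 : (0 : ℝ) < #T := by exact_mod_cast hT.card_pos
  rw [pairAvg, div_le_iff₀ (by positivity)]
  refine (Finset.sum_le_sum fun a _ => Finset.sum_le_sum fun b _ => hf _).trans (le_of_eq ?_)
  simp only [sum_const, nsmul_eq_mul]
  ring

theorem transAvg_pairAvg (S T : Finset G) (f : G → ℝ) :
    transAvg S (pairAvg T f) = pairAvg T (transAvg S f) := by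
  ext u
  simp only [transAvg, pairAvg]
  simp_rw [← Finset.sum_div]
  rw [div_div, div_div, mul_comm]
  congr 1
  rw [Finset.sum_comm]
  refine Finset.sum_congr rfl fun a _ => ?_
  rw [Finset.sum_comm]
  refine Finset.sum_congr rfl fun b _ => Finset.sum_congr rfl fun v _ => ?_
  rw [add_assoc]

theorem pairAvg_sub (T : Finset G) (f g : G → ℝ) (u : G) :
    pairAvg T (fun x => f x - g x) u = pairAvg T f u - pairAvg T g u := by
  simp only [pairAvg, Finset.sum_sub_distrib, sub_div]

end Averages

section FourierSmoothing

variable {F G : Type*} [Field F] [AddCommGroup G] [Module F G]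

/-- Normalised square of the Fourier coefficient of a finite set. -/
noncomputable def specWeight (χ : AddChar F ℂ) (A : Finset G) (φ : Module.Dual F G) : ℝ :=
  ‖∑ a ∈ A, χ (φ a)‖ ^ 2 / (#A : ℝ) ^ 2

theorem specWeight_nonneg (χ : AddChar F ℂ) (A : Finset G) (φ : Module.Dual F G) :
    0 ≤ specWeight χ A φ := by unfold specWeight; positivity

theorem sum_dual_apply (χ : AddChar F ℂ) (hχ : χ ≠ 1) [Fintype (Module.Dual F G)]
    [DecidableEq G] (x : G) : ∑ φ : Module.Dual F G, χ (φ x) =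
      if x = 0 then (Fintype.card (Module.Dual F G) : ℂ) else 0 := by
  split_ifs with hx
  · simp [hx]
  · obtain ⟨φ, hφ⟩ := not_forall.mp (mt (Module.forall_dual_apply_eq_zero_iff F x).mp hx)
    obtain ⟨c, hc⟩ := AddChar.ne_one_iff.mp hχ
    let ψ : Module.Dual F G := (c / φ x) • φ
    have hψ : χ (ψ x) ≠ 1 := by
      have : ψ x = c := by simp [ψ, hφ]
      rwa [this]
    have h1 : χ (ψ x) * ∑ φ : Module.Dual F G, χ (φ x) = ∑ φ : Module.Dual F G, χ (φ x) := by
      rw [Finset.mul_sum, ← Equiv.sum_comp (Equiv.addLeft ψ) (fun φ => χ (φ x))]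
      refine Finset.sum_congr rfl fun φ _ => ?_
      simp [AddChar.map_add_eq_mul]
    have h2 : (χ (ψ x) - 1) * ∑ φ : Module.Dual F G, χ (φ x) = 0 := by
      rw [sub_mul, h1, one_mul, sub_self]
    exact (mul_eq_zero.mp h2).resolve_left (sub_ne_zero.mpr hψ)

variable [Fintype F]

theorem ofReal_specWeight (χ : AddChar F ℂ) (A : Finset G) (φ : Module.Dual F G) :
    (specWeight χ A φ : ℂ) = (∑ a ∈ A, ∑ b ∈ A, χ (φ (a - b))) / (#A : ℂ) ^ 2 := by
  have h : (∑ a ∈ A, ∑ b ∈ A, χ (φ (a - b))) =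
      (∑ a ∈ A, χ (φ a)) * (starRingEnd ℂ) (∑ a ∈ A, χ (φ a)) := by
    rw [map_sum, Finset.sum_mul_sum]
    refine Finset.sum_congr rfl fun a _ => Finset.sum_congr rfl fun b _ => ?_
    rw [map_sub, sub_eq_add_neg, AddChar.map_add_eq_mul, AddChar.map_neg_eq_conj]
  rw [h, Complex.mul_conj', specWeight]
  push_cast
  rfl

theorem sum_specWeight (χ : AddChar F ℂ) (hχ : χ ≠ 1) [Fintype (Module.Dual F G)]
    (A : Finset G) (hA : A.Nonempty) :
    ∑ φ : Module.Dual F G, specWeight χ A φ = Fintype.card (Module.Dual F G) / #A := by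
  classical
  have hA0 : (#A : ℂ) ≠ 0 := by exact_mod_cast hA.card_pos.ne'
  apply Complex.ofReal_injective
  push_cast
  simp_rw [ofReal_specWeight]
  rw [← Finset.sum_div, Finset.sum_comm]
  have h1 : ∀ a ∈ A, ∑ φ : Module.Dual F G, ∑ b ∈ A, χ (φ (a - b)) =
      Fintype.card (Module.Dual F G) := by
    intro a ha
    rw [Finset.sum_comm]
    simp_rw [sum_dual_apply χ hχ, sub_eq_zero]
    simp [ha]
  rw [Finset.sum_congr rfl h1]
  simp only [sum_const, nsmul_eq_mul]
  field_simp

variable [Fintype G]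

/-- Fourier transform indexed by linear functionals. -/
noncomputable def dualTransform (χ : AddChar F ℂ) (f : G → ℝ) (φ : Module.Dual F G) : ℂ :=
  ∑ x, f x * χ (φ x)

theorem dualTransform_comp_add (χ : AddChar F ℂ) (f : G → ℝ) (φ : Module.Dual F G) (y : G) :
    ∑ x, (f (y + x) : ℂ) * χ (φ x) = χ (-φ y) * dualTransform χ f φ := by
  rw [dualTransform, Finset.mul_sum,
    ← Equiv.sum_comp (Equiv.addLeft y) (fun x => χ (-φ y) * (f x * χ (φ x)))]
  refine Finset.sum_congr rfl fun x _ => ?_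
  simp only [Equiv.coe_addLeft, map_add]
  rw [AddChar.map_add_eq_mul, AddChar.map_neg_eq_inv]
  have : χ (φ y) ≠ 0 := by
    rw [← norm_ne_zero_iff, AddChar.norm_apply]; exact one_ne_zero
  field_simp

theorem dualTransform_pairAvg (χ : AddChar F ℂ) (A : Finset G) (f : G → ℝ)
    (φ : Module.Dual F G) :
    dualTransform χ (pairAvg A f) φ = specWeight χ A φ * dualTransform χ f φ := by
  rw [ofReal_specWeight, dualTransform]
  simp only [pairAvg]
  push_cast
  simp_rw [div_mul_eq_mul_div, Finset.sum_mul]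
  rw [← Finset.sum_div]
  congr 1
  rw [Finset.sum_comm]
  refine Finset.sum_congr rfl fun a _ => ?_
  rw [Finset.sum_comm]
  refine Finset.sum_congr rfl fun b _ => ?_
  rw [dualTransform_comp_add, ← map_neg, neg_sub]

theorem dualTransform_transAvg (χ : AddChar F ℂ) (S : Finset G) (f : G → ℝ)
    (φ : Module.Dual F G) :
    dualTransform χ (transAvg S f) φ =
      ((∑ v ∈ S, χ (-φ v)) / #S) * dualTransform χ f φ := by
  rw [dualTransform]
  simp only [transAvg]
  push_cast
  simp_rw [div_mul_eq_mul_div, Finset.sum_mul]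
  rw [← Finset.sum_div]
  congr 1
  rw [Finset.sum_comm]
  refine Finset.sum_congr rfl fun v _ => ?_
  rw [← dualTransform_comp_add]
  simp_rw [add_comm]

theorem card_dual_mul_abs_le (χ : AddChar F ℂ) (hχ : χ ≠ 1) [Fintype (Module.Dual F G)]
    (f : G → ℝ) (u : G) :
    Fintype.card (Module.Dual F G) * |f u| ≤ ∑ φ : Module.Dual F G, ‖dualTransform χ f φ‖ := by
  classical
  have h1 : ∑ φ : Module.Dual F G, χ (-φ u) * dualTransform χ f φ =
      Fintype.card (Module.Dual F G) * f u := by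
    simp_rw [dualTransform, Finset.mul_sum]
    rw [Finset.sum_comm]
    have h2 : ∀ x, ∑ φ : Module.Dual F G, χ (-φ u) * (f x * χ (φ x)) =
        if x = u then (Fintype.card (Module.Dual F G) : ℂ) * f u else 0 := by
      intro x
      have h3 : ∀ φ : Module.Dual F G, χ (-φ u) * (f x * χ (φ x)) = f x * χ (φ (x - u)) := by
        intro φ
        rw [map_sub, sub_eq_add_neg, AddChar.map_add_eq_mul]
        ring
      simp_rw [h3]
      rw [← Finset.mul_sum, sum_dual_apply χ hχ]
      simp only [sub_eq_zero]
      split_ifs with hx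
      · rw [hx]; ring
      · simp
    simp_rw [h2]
    simp
  have h4 : (Fintype.card (Module.Dual F G) : ℝ) * |f u| =
      ‖∑ φ : Module.Dual F G, χ (-φ u) * dualTransform χ f φ‖ := by
    rw [h1]; simp
  rw [h4]
  refine (norm_sum_le _ _).trans (le_of_eq ?_)
  refine Finset.sum_congr rfl fun φ _ => ?_
  rw [norm_mul, AddChar.norm_apply, one_mul]

theorem norm_dualTransform_le (χ : AddChar F ℂ) (f : G → ℝ) (hf : ∀ x, |f x| ≤ 1)
    (φ : Module.Dual F G) : ‖dualTransform χ f φ‖ ≤ Fintype.card G := by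
  refine (norm_sum_le _ _).trans ?_
  refine (Finset.sum_le_sum (g := fun _ => (1 : ℝ)) fun x _ => ?_).trans (by simp)
  rw [norm_mul, AddChar.norm_apply, mul_one, Complex.norm_real]
  exact hf x

theorem exists_le_transAvg (χ : AddChar F ℂ) (hχ : χ ≠ 1) {A T S : Finset G} (hA : A.Nonempty)
    (hT : T.Nonempty) (hS : S.Nonempty) {f : G → ℝ} (hf : ∀ x, |f x| ≤ 1) {δ : ℝ} (l : ℕ)
    (hper : ∀ u, ∀ t ∈ T, ∀ t' ∈ T, |pairAvg A f (u + t) - pairAvg A f (u + t')| ≤ δ)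
    (hspec : ∀ φ : Module.Dual F G, (#T : ℝ) / 2 ≤ ‖∑ t ∈ T, χ (φ t)‖ → ∀ v ∈ S, φ v = 0) :
    ∃ u, pairAvg A f 0 - l * δ - 2 * (1 / 4) ^ l * (Fintype.card G / #A) ≤
      transAvg S (pairAvg A f) u := by
  classical
  have : Finite (Module.Dual F G) := Finite.of_injective (fun φ => (φ : G → F)) DFunLike.coe_injective
  have := Fintype.ofFinite (Module.Dual F G)
  set N : ℝ := ((Fintype.card G : ℕ) : ℝ) with hN
  set D : ℝ := ((Fintype.card (Module.Dual F G) : ℕ) : ℝ) with hD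
  have hD0 : 0 < D := by rw [hD]; exact_mod_cast Fintype.card_pos
  have hT0 : (0 : ℝ) < #T := by exact_mod_cast hT.card_pos
  have hS0 : (0 : ℝ) < #S := by exact_mod_cast hS.card_pos
  set P := pairAvg A f with hP
  let M : ℕ → G → ℝ := fun j => (pairAvg T)^[j] P
  have hMsucc : ∀ j, M (j + 1) = pairAvg T (M j) := fun j => Function.iterate_succ_apply' _ _ _
  have hMclose : ∀ j u, P u - M j u ≤ j * δ := by
    have hone : ∀ u, P u - pairAvg T P u ≤ δ := by
      intro u
      have h1 : P u - pairAvg T P u = pairAvg T (fun x => P u - P x) u := by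
        rw [pairAvg_sub T (fun _ => P u) P u]
        congr 1
        simp only [pairAvg, sum_const, nsmul_eq_mul]
        field_simp
      rw [h1, pairAvg, div_le_iff₀ (by positivity)]
      have h2 : ∀ a ∈ T, ∀ b ∈ T, P u - P (b - a + u) ≤ δ := by
        intro a ha b hb
        have := (abs_le.mp (hper (u - a) a ha b hb)).2
        rwa [sub_add_cancel, show u - a + b = b - a + u by abel] at this
      refine (Finset.sum_le_sum fun a ha => Finset.sum_le_sum fun b hb => h2 a ha b hb).trans
        (le_of_eq ?_)
      simp only [sum_const, nsmul_eq_mul]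
      ring
    intro j
    induction j with
    | zero => intro u; simp [M]
    | succ j ih =>
      intro u
      have h1 := pairAvg_le hT ih u
      rw [pairAvg_sub] at h1
      have h2 := hone u
      rw [hMsucc]
      push_cast
      linarith
  have hMhat : ∀ j φ, dualTransform χ (M j) φ =
      (specWeight χ T φ : ℂ) ^ j * (specWeight χ A φ * dualTransform χ f φ) := by
    intro j φ
    induction j with
    | zero => simp [M, hP, dualTransform_pairAvg]
    | succ j ih => rw [hMsucc, dualTransform_pairAvg, ih]; ring
  have hdiff : M l 0 - transAvg S (M l) 0 ≤ 2 * (1 / 4) ^ l * (N / #A) := by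
    have h1 := card_dual_mul_abs_le χ hχ (fun x => M l x - transAvg S (M l) x) 0
    have h2 : ∀ φ, ‖dualTransform χ (fun x => M l x - transAvg S (M l) x) φ‖ ≤
        2 * (1 / 4) ^ l * N * specWeight χ A φ := by
      intro φ
      have h3 : dualTransform χ (fun x => M l x - transAvg S (M l) x) φ =
          (1 - (∑ v ∈ S, χ (-φ v)) / #S) * dualTransform χ (M l) φ := by
        rw [sub_mul, one_mul, ← dualTransform_transAvg]
        simp only [dualTransform]
        push_cast
        simp_rw [sub_mul]
        rw [Finset.sum_sub_distrib]
      have hwA := specWeight_nonneg χ A φ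
      by_cases hφ : (#T : ℝ) / 2 ≤ ‖∑ t ∈ T, χ (φ t)‖
      · have h4 : ∑ v ∈ S, χ (-φ v) = #S := by
          rw [Finset.sum_congr rfl fun v hv => by rw [hspec φ hφ v hv, neg_zero,
            AddChar.map_zero_eq_one]]
          simp
        rw [h3, h4, div_self (by exact_mod_cast hS0.ne')]
        simp only [sub_self, zero_mul, norm_zero]
        positivity
      · have h4 : ‖1 - (∑ v ∈ S, χ (-φ v)) / #S‖ ≤ 2 := by
          refine (norm_sub_le _ _).trans ?_
          rw [norm_one, norm_div, Complex.norm_natCast]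
          have : ‖∑ v ∈ S, χ (-φ v)‖ / #S ≤ 1 := by
            rw [div_le_one hS0]
            refine (norm_sum_le _ _).trans ?_
            simp [AddChar.norm_apply]
          linarith
        have h5 : specWeight χ T φ ≤ 1 / 4 := by
          rw [specWeight, div_le_iff₀ (by positivity)]
          have := norm_nonneg (∑ t ∈ T, χ (φ t))
          nlinarith [not_le.mp hφ]
        rw [h3, hMhat, norm_mul, norm_mul, norm_mul, norm_pow, Complex.norm_real,
          Complex.norm_real, Real.norm_of_nonneg hwA,
          Real.norm_of_nonneg (specWeight_nonneg χ T φ)]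
        have h6 := norm_dualTransform_le χ f hf φ
        have h7 : specWeight χ T φ ^ l ≤ (1 / 4) ^ l :=
          pow_le_pow_left₀ (specWeight_nonneg χ T φ) h5 l
        have h8 := specWeight_nonneg χ T φ
        calc _ ≤ 2 * ((1 / 4) ^ l * (specWeight χ A φ * N)) := by gcongr
          _ = _ := by ring
    have h9 := h1.trans (Finset.sum_le_sum fun φ _ => h2 φ)
    rw [← Finset.mul_sum, sum_specWeight χ hχ A hA] at h9
    have h10 : D * |M l 0 - transAvg S (M l) 0| ≤ D * (2 * (1 / 4) ^ l * (N / #A)) := by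
      refine h9.trans (le_of_eq ?_)
      rw [← hD]; ring
    exact (le_abs_self _).trans (le_of_mul_le_mul_left h10 hD0)
  obtain ⟨u, hu⟩ := Finite.exists_max (transAvg S P)
  refine ⟨u, ?_⟩
  have hmax : ∀ j x, transAvg S (M j) x ≤ transAvg S P u := by
    intro j
    induction j with
    | zero => exact hu
    | succ j ih =>
      intro x
      rw [hMsucc, transAvg_pairAvg]
      exact pairAvg_le hT ih x
  linarith [hmax l 0, hMclose l 0]

end FourierSmoothing

section DensityIncrement

theorem exists_smoothing_parameters {η : ℝ} (hη : 0 < η) (hη1 : η < 1) :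
    ∃ C : ℝ, 1 ≤ C ∧ ∀ L : ℝ, 1 ≤ L → ∃ (l m : ℕ) (δ : ℝ), 0 < δ ∧ 0 < m ∧
      l * (4 * δ) ≤ η / 2 ∧ 2 * (1 / 4) ^ l * (2 : ℝ) ^ L ≤ η / 2 ∧
      4 * Real.exp (-(δ ^ 2 * m / 2)) * (2 : ℝ) ^ L ≤ δ ∧
      8 * Real.log (2 * ((2 : ℝ) ^ L) ^ m) ≤ C * L ^ 4 := by
  obtain ⟨c, hc⟩ := pow_unbounded_of_one_lt (4 / η) (one_lt_two : (1 : ℝ) < 2)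
  have hc1 : (1 : ℝ) ≤ c := by
    rcases Nat.eq_zero_or_pos c with rfl | h
    · rw [pow_zero, div_lt_one hη] at hc; linarith
    · exact_mod_cast h
  set a : ℝ := 16 * c / η with ha
  have ha0 : 0 < a := by positivity
  refine ⟨8 * (2 + 2 * a ^ 2 * (4 * a + 1)), ?_, fun L hL => ?_⟩
  · have : 0 < 2 * a ^ 2 * (4 * a + 1) := by positivity
    linarith
  have hL0 : 0 < L := by linarith
  have hcL : 1 ≤ c * L := by nlinarith
  set l : ℕ := ⌈c * L⌉₊ with hl
  have hl1 : c * L ≤ l := Nat.le_ceil _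
  have hl2 : (l : ℝ) ≤ 2 * (c * L) := by
    have := Nat.ceil_lt_add_one (a := c * L) (by linarith)
    rw [← hl] at this
    linarith
  have hl0 : (0 : ℝ) < l := by linarith
  set δ : ℝ := η / (8 * l) with hδ
  have hδ0 : 0 < δ := by positivity
  have hδa : 1 / δ ≤ a * L := by
    rw [hδ, ha, one_div_div, div_mul_eq_mul_div]
    refine div_le_div_of_nonneg_right ?_ hη.le
    linarith
  set x : ℝ := 2 / δ ^ 2 * (4 / δ + L) with hx
  have hx0 : 0 < x := by positivity
  set m : ℕ := ⌈x⌉₊ with hm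
  have hm1 : x ≤ m := Nat.le_ceil _
  have hm2 : (m : ℝ) ≤ x + 1 := (Nat.ceil_lt_add_one hx0.le).le
  refine ⟨l, m, δ, hδ0, Nat.ceil_pos.mpr hx0, ?_, ?_, ?_, ?_⟩
  · refine le_of_eq ?_
    rw [hδ]; field_simp; norm_num
  · have h1 : (2 : ℝ) ^ L * (4 / η) ≤ 4 ^ l := by
      calc (2 : ℝ) ^ L * (4 / η) ≤ (2 : ℝ) ^ L * 2 ^ (c : ℝ) := by
            rw [Real.rpow_natCast]; gcongr
        _ = (2 : ℝ) ^ (L + c) := (Real.rpow_add two_pos _ _).symm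
        _ ≤ (2 : ℝ) ^ ((2 : ℝ) * l) := by
            apply Real.rpow_le_rpow_of_exponent_le one_le_two
            nlinarith
        _ = 4 ^ l := by
            rw [Real.rpow_mul two_pos.le, Real.rpow_natCast]; norm_num
    rw [one_div, inv_pow]
    have h4 : (0 : ℝ) < 4 ^ l := by positivity
    rw [mul_right_comm, ← div_eq_mul_inv, div_le_iff₀ h4]
    rw [mul_div_assoc', div_le_iff₀ hη] at h1
    linarith
  · have h1 : 4 / δ + L ≤ δ ^ 2 * m / 2 := by
      have : δ ^ 2 * x / 2 = 4 / δ + L := by rw [hx]; field_simp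
      rw [← this]
      gcongr
    have h2 : Real.exp (-(δ ^ 2 * m / 2)) ≤ Real.exp (-(4 / δ)) * Real.exp (-L) := by
      rw [← Real.exp_add]
      apply Real.exp_le_exp.mpr
      linarith
    have h3 : (2 : ℝ) ^ L ≤ Real.exp L := by
      rw [Real.rpow_def_of_pos two_pos]
      apply Real.exp_le_exp.mpr
      have := Real.log_two_lt_d9
      nlinarith
    have h4 : Real.exp (-(4 / δ)) ≤ δ / 4 := by
      rw [Real.exp_neg, ← inv_div 4 δ]
      apply inv_anti₀ (by positivity)
      have := Real.add_one_le_exp (4 / δ)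
      linarith
    calc 4 * Real.exp (-(δ ^ 2 * m / 2)) * (2 : ℝ) ^ L
        ≤ 4 * (Real.exp (-(4 / δ)) * Real.exp (-L)) * Real.exp L := by gcongr
      _ = 4 * Real.exp (-(4 / δ)) * (Real.exp (-L) * Real.exp L) := by ring
      _ = 4 * Real.exp (-(4 / δ)) := by rw [← Real.exp_add]; simp
      _ ≤ δ := by linarith
  · have h1 : Real.log (2 * ((2 : ℝ) ^ L) ^ m) = (1 + m * L) * Real.log 2 := by
      rw [Real.log_mul two_ne_zero (by positivity), Real.log_pow, Real.log_rpow two_pos]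
      ring
    have h2 : Real.log 2 ≤ 1 := by have := Real.log_two_lt_d9; linarith
    have h3 : x ≤ 2 * a ^ 2 * (4 * a + 1) * L ^ 3 := by
      calc x = 2 * (1 / δ) ^ 2 * (4 * (1 / δ) + L) := by rw [hx]; field_simp
        _ ≤ 2 * (a * L) ^ 2 * (4 * (a * L) + L) := by gcongr
        _ = _ := by ring
    have h4 : (1 : ℝ) ≤ L ^ 3 := one_le_pow₀ hL
    have h5 : (1 : ℝ) ≤ L ^ 4 := one_le_pow₀ hL
    have h6 : (m : ℝ) * L ≤ (2 * a ^ 2 * (4 * a + 1) + 1) * L ^ 4 := by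
      have : (m : ℝ) ≤ (2 * a ^ 2 * (4 * a + 1) + 1) * L ^ 3 := by linarith
      calc (m : ℝ) * L ≤ ((2 * a ^ 2 * (4 * a + 1) + 1) * L ^ 3) * L := by gcongr
        _ = _ := by ring
    rw [h1]
    have h7 : (1 + m * L) * Real.log 2 ≤ 1 + m * L :=
      mul_le_of_le_one_right (by positivity) h2
    linarith

theorem exists_subspace_transAvg_ge {η : ℝ} (hη : 0 < η) (hη1 : η < 1) :
    ∃ C : ℝ, 1 ≤ C ∧ ∀ (F G : Type) [Field F] [Fintype F] [AddCommGroup G] [Module F G]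
      [Fintype G] [DecidableEq G], ∀ L : ℝ, 1 ≤ L → ∀ A : Finset G,
      Fintype.card G ≤ (2 : ℝ) ^ L * #A → ∀ S : Finset G, 1 - η ≤ pairAvg A (ind S) 0 →
      ∃ (V : Submodule F G) (E : Finset G) (w : G), (∀ v, v ∈ E ↔ v ∈ V) ∧
        (Module.finrank F G : ℝ) ≤ Module.finrank F V + C * L ^ 4 ∧
        1 - 2 * η ≤ transAvg E (ind S) w := by
  obtain ⟨C, hC1, hC⟩ := exists_smoothing_parameters hη hη1
  refine ⟨C, hC1, ?_⟩
  intro F G _ _ _ _ _ _ L hL A hAcard S hAS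
  classical
  obtain ⟨l, m, δ, hδ, hm, h1, h2, h3, h4⟩ := hC L hL
  set N : ℝ := ((Fintype.card G : ℕ) : ℝ) with hN
  have hN0 : 0 < N := by rw [hN]; exact_mod_cast Fintype.card_pos
  have h2L : (0 : ℝ) < (2 : ℝ) ^ L := by positivity
  have hA0 : (0 : ℝ) < #A := by
    by_contra h
    have := mul_nonpos_of_nonneg_of_nonpos h2L.le (not_lt.mp h)
    linarith
  have hA : A.Nonempty := Finset.card_pos.mp (by exact_mod_cast hA0)
  have hind0 := ind_nonneg S
  have hind1 := ind_le_one S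
  obtain ⟨T, hTcard, hTper⟩ := exists_almost_periods A hA (ind S) hind0 hind1 hδ hm (by
    rw [← hN]
    calc 4 * Real.exp (-(δ ^ 2 * m / 2)) * N
        ≤ 4 * Real.exp (-(δ ^ 2 * m / 2)) * ((2 : ℝ) ^ L * #A) := by gcongr
      _ = 4 * Real.exp (-(δ ^ 2 * m / 2)) * (2 : ℝ) ^ L * #A := by ring
      _ ≤ δ * #A := by gcongr)
  rw [← hN] at hTcard
  have hT0 : (0 : ℝ) < #T := by
    have h5 : 0 < N * (#A : ℝ) ^ m := by positivity
    have h6 : 0 < 2 * (#T : ℝ) * N ^ m := h5.trans_le hTcard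
    by_contra h
    have h7 : (#T : ℝ) = 0 := le_antisymm (not_lt.mp h) (by positivity)
    rw [h7] at h6
    simp at h6
  have hT : T.Nonempty := Finset.card_pos.mp (by exact_mod_cast hT0)
  obtain ⟨χ, hχ⟩ := (AddChar.exists_apply_ne_zero (α := F)).mpr one_ne_zero
  have hχ1 : χ ≠ 1 := fun h => hχ (by simp [h])
  obtain ⟨V, hVdim, hV⟩ := exists_annihilator χ hχ1 hT (F := F)
  have hE : ∀ v, v ∈ univ.filter (fun v => v ∈ V) ↔ v ∈ V := fun v => by simp
  obtain ⟨u, hu⟩ := exists_le_transAvg χ hχ1 hA hT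
    (S := univ.filter (fun v => v ∈ V)) ⟨0, by simp⟩ (f := ind S)
    (fun x => abs_le.mpr ⟨by linarith [hind0 x], hind1 x⟩) l hTper
    (fun φ hφ v hv => hV φ hφ v ((hE v).mp hv))
  rw [transAvg_pairAvg] at hu
  obtain ⟨w, hw⟩ := Finite.exists_max (transAvg (univ.filter (fun v => v ∈ V)) (ind S))
  refine ⟨V, _, w, hE, ?_, ?_⟩
  · refine hVdim.trans ?_
    have h5 : N / #T ≤ 2 * ((2 : ℝ) ^ L) ^ m := by
      rw [div_le_iff₀ hT0]
      have hAm : (0 : ℝ) < (#A : ℝ) ^ m := by positivity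
      refine le_of_mul_le_mul_right ?_ hAm
      refine hTcard.trans ?_
      calc 2 * (#T : ℝ) * N ^ m ≤ 2 * (#T : ℝ) * ((2 : ℝ) ^ L * #A) ^ m := by gcongr
        _ = _ := by rw [mul_pow]; ring
    have h6 := Real.log_le_log (by positivity) h5
    linarith
  · have h5 := pairAvg_le hA hw u
    have h6 : 2 * (1 / 4) ^ l * (N / #A) ≤ η / 2 := by
      refine le_trans ?_ h2
      have : N / #A ≤ (2 : ℝ) ^ L := by rwa [div_le_iff₀ hA0]
      gcongr
    linarith

theorem exists_pow_mul_le {a b c : ℝ} (ha : 0 < a) (hab : a < b) :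
    ∃ M₀ : ℕ, ∀ M, M₀ ≤ M → c * a ^ M ≤ b ^ M := by
  have h1 : 1 < b / a := by rwa [one_lt_div ha]
  obtain ⟨n, hn⟩ := pow_unbounded_of_one_lt c h1
  refine ⟨n, fun M hM => ?_⟩
  have h2 : c ≤ (b / a) ^ M := hn.le.trans (pow_le_pow_right₀ h1.le hM)
  rwa [div_pow, le_div_iff₀ (by positivity)] at h2

theorem exists_exponent {ε η : ℝ} (hε : 0 < ε) (hη : 0 < η) (hη1 : η < 1) :
    ∃ M : ℕ, 0 < M ∧ ∀ K : ℕ, 0 < K →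
      (2 + 2 ^ (K + 1)) * (1 + ε / 2) ^ (M * K) ≤ (1 + ε) ^ (M * K) ∧
      (1 + ε / 4) ^ (M * K) ≤ η / 2 * (1 + ε / 2) ^ (M * K) := by
  obtain ⟨M₁, h1⟩ := exists_pow_mul_le (a := 1 + ε / 2) (b := 1 + ε) (c := 8)
    (by linarith) (by linarith)
  obtain ⟨M₂, h2⟩ := exists_pow_mul_le (a := 1 + ε / 4) (b := 1 + ε / 2) (c := 2 / η)
    (by linarith) (by linarith)
  refine ⟨M₁ + M₂ + 1, by omega, fun K hK => ⟨?_, ?_⟩⟩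
  · have h3 := pow_le_pow_left₀ (by positivity) (h1 (M₁ + M₂ + 1) (by omega)) K
    rw [mul_pow, ← pow_mul, ← pow_mul] at h3
    refine le_trans ?_ h3
    refine mul_le_mul_of_nonneg_right ?_ (by positivity)
    have h4 : (2 : ℝ) ^ K ≥ 2 := by
      simpa using pow_le_pow_right₀ (one_le_two : (1 : ℝ) ≤ 2) hK
    have h5 : (8 : ℝ) ^ K = 2 ^ K * 2 ^ K * 2 ^ K := by
      rw [← mul_pow, ← mul_pow]; norm_num
    rw [h5, pow_succ]
    have h6 : (2 : ℝ) ^ K * 2 ^ K ≥ 4 := by nlinarith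
    nlinarith
  · have h3 := pow_le_pow_left₀ (by positivity) (h2 (M₁ + M₂ + 1) (by omega)) K
    rw [mul_pow, ← pow_mul, ← pow_mul] at h3
    have h4 : 2 / η ≤ (2 / η) ^ K :=
      le_self_pow₀ (by rw [le_div_iff₀ hη]; linarith) hK.ne'
    have h5 : 2 / η * (1 + ε / 4) ^ ((M₁ + M₂ + 1) * K) ≤
        (1 + ε / 2) ^ ((M₁ + M₂ + 1) * K) :=
      (mul_le_mul_of_nonneg_right h4 (by positivity)).trans h3
    rw [div_mul_eq_mul_div, div_le_iff₀ hη] at h5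
    linarith

theorem lt_sum_pow_of_lt_sum_rpow {α : Type*} [Fintype α] [Nonempty α] (y : α → ℝ) {ε k : ℝ}
    (hε : 0 < ε) (hk : 1 ≤ k) {K : ℕ} (hkK : k ≤ K) (hK : Even K)
    (h : ε ^ k * Fintype.card α < ∑ x, |y x| ^ k) :
    ε ^ K * Fintype.card α ≤ ∑ x, y x ^ K := by
  have hN : (0 : ℝ) < Fintype.card α := by exact_mod_cast Fintype.card_pos
  have hk0 : 0 < k := by linarith
  have h1 := Real.rpow_arith_mean_le_arith_mean_rpow (univ : Finset α)
    (fun _ => (Fintype.card α : ℝ)⁻¹) (fun x => |y x| ^ k) (fun _ _ => by positivity)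
    (by simp) (fun _ _ => by positivity)
    (p := K / k) (by rw [le_div_iff₀ hk0]; linarith)
  have h2 : ∀ x, (|y x| ^ k) ^ (K / k : ℝ) = y x ^ K := by
    intro x
    rw [← Real.rpow_mul (abs_nonneg _), mul_div_cancel₀ _ hk0.ne', Real.rpow_natCast, hK.pow_abs]
  simp_rw [h2] at h1
  rw [← Finset.mul_sum, ← Finset.mul_sum] at h1
  have h3 : (ε ^ k) ^ (K / k : ℝ) = ε ^ K := by
    rw [← Real.rpow_mul hε.le, mul_div_cancel₀ _ hk0.ne', Real.rpow_natCast]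
  have h4 : ε ^ k ≤ (Fintype.card α : ℝ)⁻¹ * ∑ x, |y x| ^ k := by
    rw [inv_mul_eq_div, le_div_iff₀ hN]; exact h.le
  have h5 := Real.rpow_le_rpow (by positivity) h4 (by positivity : (0 : ℝ) ≤ K / k)
  rw [h3] at h5
  have h6 := h5.trans h1
  rwa [inv_mul_eq_div, le_div_iff₀ hN] at h6

section Balanced

variable {G : Type*} [AddCommGroup G] [Fintype G]

/-- The balanced function of `B`, scaled to have density one before centring. -/
noncomputable def balanced (B : Finset G) (x : G) : ℝ := Fintype.card G / #B * ind B x - 1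

theorem selfConv_balanced {B : Finset G} (hB : B.Nonempty) (x : G) :
    selfConv (balanced B) x =
      Fintype.card G * (Fintype.card G * selfConv (ind B) x / (#B : ℝ) ^ 2 - 1) := by
  have hB0 : (#B : ℝ) ≠ 0 := by exact_mod_cast hB.card_pos.ne'
  have h1 : ∑ y, ind B (x - y) = #B := by
    rw [← sum_ind]; exact Equiv.sum_comp (Equiv.subLeft x) (ind B)
  set N : ℝ := ((Fintype.card G : ℕ) : ℝ) with hN
  have h2 : ∀ y, balanced B y * balanced B (x - y) =
      (N / #B) ^ 2 * (ind B y * ind B (x - y)) - N / #B * ind B y - N / #B * ind B (x - y) + 1 := by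
    intro y; simp only [balanced]; ring
  simp only [selfConv]
  simp_rw [h2]
  rw [Finset.sum_add_distrib, Finset.sum_sub_distrib, Finset.sum_sub_distrib, ← Finset.mul_sum,
    ← Finset.mul_sum, ← Finset.mul_sum, h1, sum_ind]
  simp only [sum_const, card_univ, nsmul_eq_mul, mul_one]
  rw [← hN]
  field_simp
  ring

theorem selfCorr_balanced {B : Finset G} (hB : B.Nonempty) (x : G) :
    selfCorr (balanced B) x =
      Fintype.card G * (Fintype.card G * selfCorr (ind B) x / (#B : ℝ) ^ 2 - 1) := by
  have hB0 : (#B : ℝ) ≠ 0 := by exact_mod_cast hB.card_pos.ne'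
  have h1 : ∑ y, ind B (y + x) = #B := by
    rw [← sum_ind]; exact Equiv.sum_comp (Equiv.addRight x) (ind B)
  set N : ℝ := ((Fintype.card G : ℕ) : ℝ) with hN
  have h2 : ∀ y, balanced B y * balanced B (y + x) =
      (N / #B) ^ 2 * (ind B y * ind B (y + x)) - N / #B * ind B y - N / #B * ind B (y + x) + 1 := by
    intro y; simp only [balanced]; ring
  simp only [selfCorr]
  simp_rw [h2]
  rw [Finset.sum_add_distrib, Finset.sum_sub_distrib, Finset.sum_sub_distrib, ← Finset.mul_sum,
    ← Finset.mul_sum, ← Finset.mul_sum, h1, sum_ind]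
  simp only [sum_const, card_univ, nsmul_eq_mul, mul_one]
  rw [← hN]
  field_simp
  ring

theorem le_sum_selfCorr_pow {B : Finset G} (hB : B.Nonempty) {ε k : ℝ} (hε : 0 < ε) (hε1 : ε ≤ 1)
    (hk : 1 ≤ k) {K p : ℕ} (hkK : k ≤ K) (hKe : Even K)
    (hp : (2 + 2 ^ (K + 1)) * (1 + ε / 2) ^ p ≤ (1 + ε) ^ p)
    (h : ε ^ k * Fintype.card G <
      ∑ x, |Fintype.card G * selfConv (ind B) x / (#B : ℝ) ^ 2 - 1| ^ k) :
    (1 + ε / 2) ^ p * Fintype.card G * ((#B : ℝ) ^ 2 / Fintype.card G) ^ p ≤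
      ∑ x, selfCorr (ind B) x ^ p := by
  have hB0 : (0 : ℝ) < #B := by exact_mod_cast hB.card_pos
  have hK0 : 0 < K := by
    have : (0 : ℝ) < K := by linarith
    exact_mod_cast this
  have h0 := lt_sum_pow_of_lt_sum_rpow _ hε hk hkK hKe h
  set N : ℝ := ((Fintype.card G : ℕ) : ℝ) with hN
  have hN0 : 0 < N := by rw [hN]; exact_mod_cast Fintype.card_pos
  let g : G → ℝ := fun x => N * selfCorr (ind B) x / (#B : ℝ) ^ 2 - 1
  have hg : ∀ x, g x = selfCorr (balanced B) x / N := by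
    intro x
    rw [selfCorr_balanced hB, ← hN, mul_div_cancel_left₀ _ hN0.ne']
  have hgj : ∀ j : ℕ, ∑ x, g x ^ j = (∑ x, selfCorr (balanced B) x ^ j) / N ^ j := by
    intro j
    simp_rw [hg, div_pow]
    rw [Finset.sum_div]
  have hg0 : ∀ j : ℕ, 0 ≤ ∑ x, g x ^ j := by
    intro j
    rw [hgj]
    exact div_nonneg (sum_selfCorr_pow_nonneg _ _) (by positivity)
  have hgK : ε ^ K * N ≤ ∑ x, g x ^ K := by
    refine h0.trans ?_
    rw [hgj, le_div_iff₀ (by positivity)]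
    refine le_trans (le_of_eq ?_) (sum_selfConv_pow_le (balanced B) K)
    rw [Finset.sum_mul]
    refine Finset.sum_congr rfl fun x _ => ?_
    rw [selfConv_balanced hB, ← hN, ← mul_pow, mul_comm]
  have h1 := le_sum_one_add_pow g hg0 hε hε1 hK0 hKe hgK hp
  have h2 : ∀ x, (1 + g x) ^ p = selfCorr (ind B) x ^ p / ((#B : ℝ) ^ 2 / N) ^ p := by
    intro x
    rw [← div_pow]
    congr 1
    simp only [g]
    field_simp
    ring
  simp_rw [h2] at h1
  rwa [← Finset.sum_div, le_div_iff₀ (by positivity)] at h1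

end Balanced

theorem exists_density_increment {ε : ℝ} (hε : 0 < ε) (hε1 : ε < 1) :
    ∃ C : ℝ, 1 ≤ C ∧ ∀ (F G : Type) [Field F] [Fintype F] [AddCommGroup G] [Module F G]
      [Fintype G] [DecidableEq G], ∀ k : ℝ, 1 ≤ k → ∀ d : ℝ, 1 ≤ d → ∀ B : Finset G,
      (2 : ℝ) ^ (-d) * Fintype.card G ≤ #B →
      ε ^ k * Fintype.card G <
        ∑ x, |Fintype.card G * selfConv (ind B) x / (#B : ℝ) ^ 2 - 1| ^ k →
      ∃ (V : Submodule F G) (E : Finset G) (w : G), (∀ v, v ∈ E ↔ v ∈ V) ∧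
        (Module.finrank F G : ℝ) ≤ Module.finrank F V + C * (d * k) ^ 4 ∧
        (1 + ε / 8) * #B * #E ≤ Fintype.card G * ∑ v ∈ E, ind B (w + v) := by
  set η : ℝ := ε / 32 with hη
  have hη0 : 0 < η := by positivity
  have hη1 : η < 1 := by rw [hη]; linarith
  obtain ⟨C, hC1, hC⟩ := exists_subspace_transAvg_ge hη0 hη1
  obtain ⟨M, hM0, hM⟩ := exists_exponent hε hη0 hη1
  have hM1 : (1 : ℝ) ≤ M := by exact_mod_cast hM0
  refine ⟨C * (5 * M) ^ 4, ?_, ?_⟩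
  · exact one_le_mul_of_one_le_of_one_le hC1 (one_le_pow₀ (by linarith))
  intro F G _ _ _ _ _ _ k hk d hd B hBd hBk
  classical
  set N : ℝ := ((Fintype.card G : ℕ) : ℝ) with hN
  have hN0 : 0 < N := by rw [hN]; exact_mod_cast Fintype.card_pos
  have hB0 : (0 : ℝ) < #B := lt_of_lt_of_le (by positivity) hBd
  have hB : B.Nonempty := Finset.card_pos.mp (by exact_mod_cast hB0)
  set K : ℕ := 2 * ⌈k⌉₊ with hK
  have hkK : k ≤ K := by
    have := Nat.le_ceil k
    rw [hK]; push_cast; linarith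
  have hK4 : (K : ℝ) ≤ 4 * k := by
    have := Nat.ceil_lt_add_one (a := k) (by linarith)
    rw [hK]; push_cast; linarith
  have hK0 : 0 < K := by
    have : (0 : ℝ) < K := by linarith
    exact_mod_cast this
  obtain ⟨hp1, hp2⟩ := hM K hK0
  set p : ℕ := M * K with hp
  have hlarge := le_sum_selfCorr_pow hB hε hε1.le hk hkK (even_two_mul _) hp1 hBk
  rw [← hN] at hlarge
  set D : ℝ := (#B : ℝ) ^ 2 / N with hD
  have hD0 : 0 < D := by positivity
  let S : Finset G := univ.filter fun x => (1 + ε / 4) * D ≤ selfCorr (ind B) x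
  have hcorr0 : ∀ x, 0 ≤ selfCorr (ind B) x := fun x =>
    Finset.sum_nonneg fun y _ => mul_nonneg (ind_nonneg _ _) (ind_nonneg _ _)
  obtain ⟨A, hA, hAcard, hAS⟩ := exists_sift B S (p := p) (η := η) (by positivity) hη0 hlarge (by
    intro x hx
    have hx' : selfCorr (ind B) x ≤ (1 + ε / 4) * D := by
      have : ¬ (1 + ε / 4) * D ≤ selfCorr (ind B) x := by simpa [S] using hx
      exact (not_le.mp this).le
    calc selfCorr (ind B) x ^ p * N ≤ ((1 + ε / 4) * D) ^ p * N := by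
          gcongr
          exact hcorr0 x
      _ = (1 + ε / 4) ^ p * (D ^ p * N) := by rw [mul_pow]; ring
      _ ≤ η / 2 * (1 + ε / 2) ^ p * (D ^ p * N) := by gcongr
      _ = _ := by ring)
  rw [← hN] at hAcard
  set L : ℝ := d * p + 1 with hL
  have hL1 : 1 ≤ L := by
    have : 0 ≤ d * p := by positivity
    linarith
  have hNA : N ≤ (2 : ℝ) ^ L * #A := by
    have hNB : N ≤ (2 : ℝ) ^ d * #B := by
      rw [Real.rpow_neg two_pos.le, inv_mul_le_iff₀ (by positivity)] at hBd
      exact hBd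
    have h1 : N ^ 2 * D ^ p ≤ 2 * (#A : ℝ) ^ 2 * N ^ p := by
      refine le_trans ?_ hAcard
      have : 1 ≤ (1 + ε / 2) ^ p := one_le_pow₀ (by linarith)
      have h2 : 0 ≤ N * D ^ p * N := by positivity
      nlinarith
    have h2 : N ^ 2 * ((#B : ℝ) ^ p) ^ 2 ≤ 2 * (#A : ℝ) ^ 2 * (N ^ p) ^ 2 := by
      rw [hD, div_pow, mul_div_assoc', div_le_iff₀ (by positivity)] at h1
      calc _ = N ^ 2 * ((#B : ℝ) ^ 2) ^ p := by ring
        _ ≤ _ := h1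
        _ = _ := by ring
    have h3 : N ^ p ≤ (2 : ℝ) ^ (d * p) * (#B : ℝ) ^ p := by
      rw [Real.rpow_mul two_pos.le, Real.rpow_natCast, ← mul_pow]
      exact pow_le_pow_left₀ hN0.le hNB p
    have h4 : N ^ 2 * ((#B : ℝ) ^ p) ^ 2 ≤
        (2 * (#A : ℝ) ^ 2 * ((2 : ℝ) ^ (d * p)) ^ 2) * ((#B : ℝ) ^ p) ^ 2 := by
      refine h2.trans ?_
      calc 2 * (#A : ℝ) ^ 2 * (N ^ p) ^ 2
          ≤ 2 * (#A : ℝ) ^ 2 * ((2 : ℝ) ^ (d * p) * (#B : ℝ) ^ p) ^ 2 := by gcongr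
        _ = _ := by ring
    have h5 := le_of_mul_le_mul_right h4 (by positivity)
    refine (pow_le_pow_iff_left₀ hN0.le (by positivity) two_ne_zero).mp ?_
    rw [hL, Real.rpow_add two_pos, Real.rpow_one]
    have h6 : 0 ≤ (#A : ℝ) ^ 2 * ((2 : ℝ) ^ (d * p)) ^ 2 := by positivity
    calc N ^ 2 ≤ 2 * (#A : ℝ) ^ 2 * ((2 : ℝ) ^ (d * p)) ^ 2 := h5
      _ ≤ 4 * ((#A : ℝ) ^ 2 * ((2 : ℝ) ^ (d * p)) ^ 2) := by linarith
      _ = _ := by ring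
  obtain ⟨V, E, w, hE, hVdim, hVS⟩ := hC F G L hL1 A hNA S hAS
  have hE0 : (0 : ℝ) < #E := by
    have : E.Nonempty := ⟨0, (hE 0).mpr V.zero_mem⟩
    exact_mod_cast this.card_pos
  have hsumS : (1 + ε / 8) * D * #E ≤ ∑ v ∈ E, selfCorr (ind B) (w + v) := by
    rw [transAvg, le_div_iff₀ hE0] at hVS
    have h1 : ∀ v ∈ E, (1 + ε / 4) * D * ind S (w + v) ≤ selfCorr (ind B) (w + v) := by
      intro v _
      by_cases h : w + v ∈ S
      · rw [ind_of_mem h, mul_one]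
        simpa [S] using h
      · rw [ind_of_notMem h, mul_zero]
        exact hcorr0 _
    refine le_trans ?_ (Finset.sum_le_sum h1)
    rw [← Finset.mul_sum]
    have h2 : 1 + ε / 8 ≤ (1 + ε / 4) * (1 - 2 * η) := by rw [hη]; nlinarith
    calc (1 + ε / 8) * D * #E ≤ ((1 + ε / 4) * (1 - 2 * η)) * D * #E := by gcongr
      _ = (1 + ε / 4) * D * ((1 - 2 * η) * #E) := by ring
      _ ≤ _ := by gcongr
  have hswap : ∑ v ∈ E, selfCorr (ind B) (w + v) = ∑ y ∈ B, ∑ v ∈ E, ind B (y + w + v) := by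
    simp only [selfCorr]
    rw [Finset.sum_comm, ← sum_ind_mul B fun y => ∑ v ∈ E, ind B (y + w + v)]
    refine Finset.sum_congr rfl fun y _ => ?_
    rw [Finset.mul_sum]
    simp_rw [add_assoc]
  have havg : ∑ y ∈ B, ((1 + ε / 8) * #B * #E / N) ≤ ∑ y ∈ B, ∑ v ∈ E, ind B (y + w + v) := by
    rw [← hswap]
    refine le_trans (le_of_eq ?_) hsumS
    rw [hD]
    simp only [sum_const, nsmul_eq_mul]
    ring
  obtain ⟨y, -, hy⟩ := Finset.exists_le_of_sum_le hB havg
  refine ⟨V, E, y + w, hE, hVdim.trans ?_, ?_⟩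
  · have h1 : L ≤ 5 * M * (d * k) := by
      have h2 : (p : ℝ) ≤ M * (4 * k) := by
        rw [hp]; push_cast; gcongr
      have h3 : d * p ≤ d * (M * (4 * k)) := by gcongr
      have h4 : 1 ≤ M * (d * k) :=
        one_le_mul_of_one_le_of_one_le hM1 (one_le_mul_of_one_le_of_one_le hd hk)
      rw [hL]
      linarith
    have h2 : L ^ 4 ≤ (5 * M * (d * k)) ^ 4 := by gcongr
    have h3 : C * L ^ 4 ≤ C * (5 * M * (d * k)) ^ 4 := by gcongr
    rw [mul_pow] at h3
    linarith
  · rw [div_le_iff₀ hN0] at hy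
    linarith

end DensityIncrement

section CosetSlices

variable {F M : Type*} [Field F] [AddCommGroup M] [Module F M]

/-- The part of `A` lying in the affine subspace `x + W`. -/
noncomputable def cosetSlice (A : Finset M) (x : M) (W : Submodule F M) : Finset M :=
  open Classical in A.filter fun a => a - x ∈ W

theorem mem_cosetSlice {A : Finset M} {x a : M} {W : Submodule F M} :
    a ∈ cosetSlice A x W ↔ a ∈ A ∧ a - x ∈ W := by
  simp [cosetSlice]

/-- The logarithm of the density of `A` on `x + W`, rewarded by `θ` for each dimension of `W`. -/
noncomputable def sliceScore (θ : ℝ) (A : Finset M) (x : M) (W : Submodule F M) : ℝ :=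
  Real.log (#(cosetSlice A x W) / Nat.card W) + θ * Module.finrank F W

theorem exists_sliceScore_max [Finite M] (θ : ℝ) {A : Finset M} (hA : A.Nonempty) :
    ∃ (x : M) (W : Submodule F M), (cosetSlice A x W).Nonempty ∧
      ∀ (y : M) (V : Submodule F M), (cosetSlice A y V).Nonempty →
        sliceScore θ A y V ≤ sliceScore θ A x W := by
  obtain ⟨a, ha⟩ := hA
  obtain ⟨⟨x, W⟩, hxW, hmax⟩ := Set.exists_max_image
    {p : M × Submodule F M | (cosetSlice A p.1 p.2).Nonempty}
    (fun p => sliceScore θ A p.1 p.2) (Set.toFinite _)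
    ⟨(a, ⊤), a, mem_cosetSlice.mpr ⟨ha, by simp⟩⟩
  exact ⟨x, W, hxW, fun y V h => hmax (y, V) h⟩

theorem mem_affineSpan_cosetSlice_iff [Fintype F] [Finite M] {θ : ℝ} (hθ : θ < Real.log 2)
    {A : Finset M} {x : M} {W : Submodule F M} (hne : (cosetSlice A x W).Nonempty)
    (hmax : ∀ (y : M) (V : Submodule F M), (cosetSlice A y V).Nonempty →
      sliceScore θ A y V ≤ sliceScore θ A x W) :
    (affineSpan F (cosetSlice A x W : Set M)).direction = W ∧
      ∀ y, y ∈ affineSpan F (cosetSlice A x W : Set M) ↔ y - x ∈ W := by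
  obtain ⟨a, ha⟩ := hne
  have hax := (mem_cosetSlice.mp ha).2
  set P := affineSpan F (cosetSlice A x W : Set M) with hP
  have haP : a ∈ P := subset_affineSpan F _ ha
  have hle : P.direction ≤ W := by
    rw [hP, direction_affineSpan, vectorSpan_def, Submodule.span_le]
    rintro _ ⟨b, hb, c, hc, rfl⟩
    have := W.sub_mem (mem_cosetSlice.mp hb).2 (mem_cosetSlice.mp hc).2
    simpa using this
  have hsub : cosetSlice A x W ⊆ cosetSlice A a P.direction := fun b hb =>
    mem_cosetSlice.mpr ⟨(mem_cosetSlice.mp hb).1,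
      AffineSubspace.vsub_mem_direction (subset_affineSpan F _ hb) haP⟩
  have hdir : P.direction = W := by
    refine Submodule.eq_of_le_of_finrank_le hle ?_
    by_contra! hlt
    have hscore := hmax a P.direction ⟨a, hsub ha⟩
    have hcW : (0 : ℝ) < Nat.card W := by exact_mod_cast Nat.card_pos
    have hcP : (0 : ℝ) < Nat.card P.direction := by exact_mod_cast Nat.card_pos
    have hc1 : (0 : ℝ) < #(cosetSlice A x W) := by
      exact_mod_cast Finset.card_pos.mpr ⟨a, ha⟩
    have hc2 : (#(cosetSlice A x W) : ℝ) ≤ #(cosetSlice A a P.direction) := by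
      exact_mod_cast Finset.card_le_card hsub
    have hc3 : (0 : ℝ) < #(cosetSlice A a P.direction) := hc1.trans_le hc2
    have hlog := Real.log_le_log hc1 hc2
    have hq : (2 : ℝ) ≤ Fintype.card F := by
      exact_mod_cast Fintype.one_lt_card
    have hq2 := Real.log_le_log two_pos hq
    rw [sliceScore, sliceScore, Real.log_div hc3.ne' hcP.ne', Real.log_div hc1.ne' hcW.ne',
      Module.natCard_eq_pow_finrank (K := F), Module.natCard_eq_pow_finrank (K := F) (V := W),
      Nat.card_eq_fintype_card] at hscore
    push_cast at hscore
    rw [Real.log_pow, Real.log_pow] at hscore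
    have hlt' : (Module.finrank F P.direction : ℝ) < Module.finrank F W := by exact_mod_cast hlt
    nlinarith
  refine ⟨hdir, fun y => ?_⟩
  have hy : y ∈ P ↔ y - a ∈ P.direction := by
    rw [← vsub_eq_sub, AffineSubspace.vsub_right_mem_direction_iff_mem haP]
  rw [hy, hdir]
  have : y - x = (y - a) + (a - x) := by abel
  rw [this]
  exact (W.add_mem_iff_left hax).symm

theorem repDist_cosetSlice [DecidableEq M] (A : Finset M) (x : M) (W : Submodule F M)
    [Fintype W] {B : Finset W} (hB : ∀ w : W, w ∈ B ↔ x + w ∈ A) (w : W) :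
    repDist (cosetSlice A x W) (x + x + w) = selfConv (ind B) w / (#B : ℝ) ^ 2 ∧
      #(cosetSlice A x W) = #B := by
  classical
  have hcard : #(cosetSlice A x W) = #B := by
    refine (Finset.card_bij (fun (b : W) _ => x + (b : M)) ?_ ?_ ?_).symm
    · intro b hb
      exact mem_cosetSlice.mpr ⟨(hB b).mp hb, by simp⟩
    · intro b _ c _ h
      exact Subtype.ext (add_left_cancel h)
    · intro a ha
      obtain ⟨h1, h2⟩ := mem_cosetSlice.mp ha
      exact ⟨⟨a - x, h2⟩, (hB _).mpr (by simpa using h1), by simp⟩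
  refine ⟨?_, hcard⟩
  have hconv : selfConv (ind B) w = #{b ∈ B | w - b ∈ B} := by
    rw [selfConv, sum_ind_mul, Finset.card_filter]
    push_cast
    refine Finset.sum_congr rfl fun b _ => ?_
    split_ifs with h
    · exact ind_of_mem h
    · exact ind_of_notMem h
  rw [repDist, hconv, hcard]
  congr 2
  refine (Finset.card_bij (fun (b : W) _ => (x + (b : M), x + ((w - b : W) : M))) ?_ ?_ ?_).symm
  · intro b hb
    rw [Finset.mem_filter] at hb
    rw [Finset.mem_filter, Finset.mem_product, mem_cosetSlice, mem_cosetSlice]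
    refine ⟨⟨⟨(hB _).mp hb.1, by simp⟩, (hB _).mp hb.2, ?_⟩, ?_⟩
    · rw [add_sub_cancel_left]
      exact (w - b).2
    · push_cast
      abel
  · intro b _ c _ h
    exact Subtype.ext (add_left_cancel (Prod.ext_iff.mp h).1)
  · rintro ⟨a, b⟩ h
    rw [Finset.mem_filter, Finset.mem_product, mem_cosetSlice, mem_cosetSlice] at h
    obtain ⟨⟨⟨h1, h2⟩, h3, h4⟩, h5⟩ := h
    have hb : x + ((w - ⟨a - x, h2⟩ : W) : M) = b := by
      push_cast
      have h5 : a + b = x + x + w := h5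
      rw [← sub_eq_zero] at h5 ⊢
      rw [← neg_eq_zero, ← h5]
      abel
    refine ⟨⟨a - x, h2⟩, Finset.mem_filter.mpr ⟨(hB _).mpr (by simpa using h1),
      (hB _).mpr (by rwa [hb])⟩, Prod.ext (by simp) hb⟩

theorem kNormDivergence_cosetSlice [Fintype M] [DecidableEq M] (A : Finset M) (x : M)
    (W : Submodule F M) [Fintype W] {B : Finset W} (hB : ∀ w : W, w ∈ B ↔ x + w ∈ A)
    {S : Set M} (hS : ∀ y, y ∈ S ↔ y - (x + x) ∈ W) {k : ℝ} (hk : 1 ≤ k) :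
    kNormDivergence k (repDist (cosetSlice A x W)) (uniformOn S) =
      ((∑ w, |Fintype.card W * selfConv (ind B) w / (#B : ℝ) ^ 2 - 1| ^ k) /
        Fintype.card W) ^ (1 / k) := by
  have hk0 : k ≠ 0 := by linarith
  have hinj : Function.Injective fun w : W => x + x + (w : M) := fun v w h =>
    Subtype.ext (add_left_cancel h)
  have hrange : ∀ y, y ∉ Set.range (fun w : W => x + x + (w : M)) → y ∉ S := by
    intro y hy h
    exact hy ⟨⟨_, (hS y).mp h⟩, by simp⟩
  have hncard : (S.ncard : ℝ) = Fintype.card W := by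
    have : S = Set.range fun w : W => x + x + (w : M) := by
      ext y
      refine ⟨fun h => by_contra fun h' => hrange y h' h, ?_⟩
      rintro ⟨w, rfl⟩
      simp [hS]
    rw [this, Set.ncard_range_of_injective hinj, Nat.card_eq_fintype_card]
  have hN : (0 : ℝ) < Fintype.card W := by exact_mod_cast Fintype.card_pos
  have hin : ∀ w : W, uniformOn S (x + x + w) = 1 / (Fintype.card W : ℝ) := by
    intro w
    rw [uniformOn, Set.indicator_of_mem ((hS _).mpr (by simp)), hncard, Pi.one_apply]
  have hout : ∀ y, y ∉ S → uniformOn S y = 0 := by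
    intro y hy
    rw [uniformOn, Set.indicator_of_notMem hy, zero_div]
  have hrep : ∀ y, y ∉ S → repDist (cosetSlice A x W) y = 0 := by
    intro y hy
    rw [repDist, Finset.card_eq_zero.mpr, Nat.cast_zero, zero_div]
    refine Finset.filter_eq_empty_iff.mpr ?_
    rintro ⟨a, b⟩ hab rfl
    rw [Finset.mem_product, mem_cosetSlice, mem_cosetSlice] at hab
    refine hy ((hS _).mpr ?_)
    have := W.add_mem hab.1.2 hab.2.2
    rwa [sub_add_sub_comm] at this
  have hnum : ∑ y, |repDist (cosetSlice A x W) y - uniformOn S y| ^ k =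
      (1 / (Fintype.card W : ℝ)) ^ k *
        ∑ w, |Fintype.card W * selfConv (ind B) w / (#B : ℝ) ^ 2 - 1| ^ k := by
    rw [Finset.mul_sum]
    refine (Fintype.sum_of_injective _ hinj _ _ (fun y hy => ?_) fun w => ?_).symm
    · rw [hrep y (hrange y hy), hout y (hrange y hy), sub_zero, abs_zero, Real.zero_rpow hk0]
    · rw [(repDist_cosetSlice A x W hB w).1, hin, ← Real.mul_rpow (by positivity) (abs_nonneg _)]
      congr 1
      rw [← abs_of_pos (one_div_pos.mpr hN), ← abs_mul, abs_of_pos (one_div_pos.mpr hN)]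
      congr 1
      field_simp
  have hden : ∑ y, uniformOn S y ^ k = Fintype.card W * (1 / (Fintype.card W : ℝ)) ^ k := by
    rw [← Fintype.sum_of_injective _ hinj (fun _ : W => (1 / (Fintype.card W : ℝ)) ^ k) _
      (fun y hy => ?_) fun w => ?_]
    · simp
    · rw [hout y (hrange y hy), Real.zero_rpow hk0]
    · rw [hin]
  have hpow : 0 < (1 / (Fintype.card W : ℝ)) ^ k := Real.rpow_pos_of_pos (by positivity) k
  rw [kNormDivergence, hnum, hden]
  congr 1
  field_simp

theorem sliceScore_lt_of_density_increment [Finite M] {A : Finset M} {x : M} {W : Submodule F M}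
    [Fintype W] {B : Finset W} (hB : ∀ w : W, w ∈ B ↔ x + w ∈ A) (hne : B.Nonempty)
    (hcard : #(cosetSlice A x W) = #B) {V : Submodule F W} {E : Finset W}
    (hE : ∀ v, v ∈ E ↔ v ∈ V) {w : W} {c K θ : ℝ} (hc : 0 < c) (hθ : 0 ≤ θ)
    (hK : Module.finrank F W ≤ Module.finrank F V + K) (hθK : θ * K < Real.log c)
    (hinc : c * #B * #E ≤ Fintype.card W * ∑ v ∈ E, ind B (w + v)) :
    (cosetSlice A (x + w) (V.map W.subtype)).Nonempty ∧
      sliceScore θ A x W < sliceScore θ A (x + w) (V.map W.subtype) := by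
  classical
  have hcount : (#(cosetSlice A (x + w) (V.map W.subtype)) : ℝ) = ∑ v ∈ E, ind B (w + v) := by
    have : ∑ v ∈ E, ind B (w + v) = #{v ∈ E | w + v ∈ B} := by
      rw [Finset.card_filter]
      push_cast
      refine Finset.sum_congr rfl fun v _ => ?_
      split_ifs with h
      · exact ind_of_mem h
      · exact ind_of_notMem h
    rw [this]
    congr 1
    refine (Finset.card_bij (fun (v : W) _ => x + w + (v : M)) ?_ ?_ ?_).symm
    · intro v hv
      rw [Finset.mem_filter, hE, hB] at hv
      refine mem_cosetSlice.mpr ⟨by simpa [add_assoc] using hv.2, ?_⟩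
      rw [add_sub_cancel_left]
      exact Submodule.mem_map_of_mem hv.1
    · intro v _ v' _ h
      exact Subtype.ext (add_left_cancel h)
    · intro a ha
      obtain ⟨h1, v, hv, h2⟩ := mem_cosetSlice.mp ha
      have h2 : (v : M) = a - (x + w) := h2
      have h3 : x + w + (v : M) = a := by rw [h2]; abel
      refine ⟨v, Finset.mem_filter.mpr ⟨(hE v).mpr hv, (hB _).mpr ?_⟩, h3⟩
      rw [Submodule.coe_add, ← add_assoc, h3]
      exact h1
  have hcardV : Nat.card (V.map W.subtype) = #E := by
    have h1 : Nat.card (V.map W.subtype) = Nat.card V :=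
      (Nat.card_congr (Submodule.equivMapOfInjective W.subtype W.subtype_injective V).toEquiv).symm
    rw [h1, ← Nat.card_eq_finsetCard]
    exact Nat.card_congr (Equiv.subtypeEquivRight fun v => (hE v).symm)
  have hfin : Module.finrank F (V.map W.subtype) = Module.finrank F V :=
    Submodule.finrank_map_subtype_eq W V
  have hE0 : (0 : ℝ) < #E := by
    exact_mod_cast Finset.card_pos.mpr ⟨0, (hE 0).mpr V.zero_mem⟩
  have hB0 : (0 : ℝ) < #B := by exact_mod_cast hne.card_pos
  have hW0 : (0 : ℝ) < Fintype.card W := by exact_mod_cast Fintype.card_pos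
  rw [← hcount] at hinc
  have hS0 : (0 : ℝ) < #(cosetSlice A (x + w) (V.map W.subtype)) := by
    by_contra! h
    have h1 : 0 < c * #B * #E := by positivity
    nlinarith
  refine ⟨Finset.card_pos.mp (by exact_mod_cast hS0), ?_⟩
  have hlog : Real.log c + Real.log (#B / Fintype.card W) ≤
      Real.log (#(cosetSlice A (x + w) (V.map W.subtype)) / #E) := by
    rw [← Real.log_mul hc.ne' (by positivity)]
    refine Real.log_le_log (by positivity) ?_
    rw [mul_div_assoc', div_le_div_iff₀ hW0 hE0]
    linarith
  rw [sliceScore, sliceScore, hcardV, hcard, hfin, Nat.card_eq_fintype_card]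
  nlinarith

end CosetSlices

end Sumsets

/-- Robust structural lemma: a large subset `A' ⊆ A` whose representation distribution
`r_{A'}` is `ε`-close (in `k`-norm divergence) to uniform on `Span*(A') + Span*(A')`. -/
theorem robust_sunflower :
    ∀ ε : ℝ, 0 < ε → ε < 1 →
    ∃ C : ℝ, 1 ≤ C ∧ ∀ (F : Type) [Field F] [Fintype F] [DecidableEq F] (n : ℕ), 1 ≤ n →
      ∀ k : ℝ, 1 ≤ k → ∀ d : ℝ, 1 ≤ d → ∀ A : Finset (Fin n → F),
      (2:ℝ) ^ (-d) * (Fintype.card F : ℝ) ^ n ≤ A.card →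
      ∃ A' : Finset (Fin n → F), A' ⊆ A ∧ A'.Nonempty ∧
        -- (i)
        (A.card : ℝ) * (affineSpan F (A' : Set (Fin n → F)) : Set (Fin n → F)).ncard ≤
          (A'.card : ℝ) * (Fintype.card F : ℝ) ^ n ∧
        -- (ii)
        ((n : ℝ) - Module.finrank F (affineSpan F (A' : Set (Fin n → F))).direction) ≤
          C * d ^ 5 * k ^ 4 ∧
        -- (iii)
        kNormDivergence k (repDist A')
          (uniformOn ((affineSpan F (A' : Set (Fin n → F)) : Set (Fin n → F)) +
            (affineSpan F (A' : Set (Fin n → F)) : Set (Fin n → F)))) ≤ ε := by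
  intro ε hε hε1
  obtain ⟨C, hC1, hC⟩ := exists_density_increment hε hε1
  set t : ℝ := Real.log (1 + ε / 16) with ht
  have ht0 : 0 < t := Real.log_pos (by linarith)
  have ht2 : t < Real.log 2 := Real.log_lt_log (by linarith) (by linarith)
  have hlog2 : Real.log 2 < 1 := by linarith [Real.log_two_lt_d9]
  refine ⟨C / t, by rw [le_div_iff₀ ht0]; linarith, ?_⟩
  intro F _ _ _ n _ k hk d hd A hA
  set K : ℝ := C * (d * k) ^ 4 with hK
  have hK1 : 1 ≤ K := one_le_mul_of_one_le_of_one_le hC1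
    (one_le_pow₀ (one_le_mul_of_one_le_of_one_le hd hk))
  have hK0 : 0 < K := by linarith
  set θ : ℝ := t / K with hθ
  have hθ0 : 0 < θ := by positivity
  have hθK : θ * K = t := div_mul_cancel₀ t hK0.ne'
  have hθ2 : θ < Real.log 2 := (div_le_self ht0.le hK1).trans_lt ht2
  have hq0 : (0 : ℝ) < (Fintype.card F : ℝ) ^ n := by
    have : (0 : ℝ) < Fintype.card F := by exact_mod_cast Fintype.card_pos
    positivity
  have hA0 : (0 : ℝ) < A.card := lt_of_lt_of_le (by positivity) hA
  have hAne : A.Nonempty := Finset.card_pos.mp (by exact_mod_cast hA0)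
  obtain ⟨x, W, hne, hmax⟩ := exists_sliceScore_max (F := F) θ hAne
  obtain ⟨hdir, hmem⟩ := mem_affineSpan_cosetSlice_iff hθ2 hne hmax
  set A' := cosetSlice A x W with hA'
  have hsub : A' ⊆ A := fun a ha => (mem_cosetSlice.mp ha).1
  have hA'0 : (0 : ℝ) < A'.card := by exact_mod_cast hne.card_pos
  let _ : Fintype W := Fintype.ofFinite W
  have hW0 : (0 : ℝ) < Fintype.card W := by exact_mod_cast Fintype.card_pos
  obtain ⟨B, hB⟩ : ∃ B : Finset W, ∀ w : W, w ∈ B ↔ x + w ∈ A :=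
    ⟨Finset.univ.filter fun w => x + w ∈ A, fun w => by simp⟩
  have hcardB : A'.card = B.card := (repDist_cosetSlice A x W hB 0).2
  have hfinW : (Module.finrank F W : ℝ) ≤ n := by
    have := Submodule.finrank_le W
    rw [Module.finrank_fin_fun] at this
    exact_mod_cast this
  have htop : Real.log (A.card / (Fintype.card F : ℝ) ^ n) + θ * n ≤
      Real.log (A'.card / Fintype.card W) + θ * Module.finrank F W := by
    have h1 : cosetSlice A 0 (⊤ : Submodule F (Fin n → F)) = A := by
      ext a
      simp [mem_cosetSlice]
    have h2 := hmax 0 ⊤ (by rwa [h1])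
    rw [sliceScore, sliceScore, h1, finrank_top, Module.finrank_fin_fun,
      Nat.card_eq_fintype_card (α := W)] at h2
    have h3 : Nat.card (⊤ : Submodule F (Fin n → F)) = Fintype.card F ^ n := by
      rw [Module.natCard_eq_pow_finrank (K := F), finrank_top, Module.finrank_fin_fun,
        Nat.card_eq_fintype_card]
    rw [h3] at h2
    exact_mod_cast h2
  have hdens : A.card / (Fintype.card F : ℝ) ^ n ≤ A'.card / Fintype.card W := by
    rw [← Real.log_le_log_iff (by positivity) (by positivity)]
    nlinarith
  have hdensA : (2 : ℝ) ^ (-d) ≤ A.card / (Fintype.card F : ℝ) ^ n := by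
    rwa [le_div_iff₀ hq0]
  have hncard : ((affineSpan F (A' : Set (Fin n → F)) : Set (Fin n → F)).ncard : ℝ) =
      Fintype.card W := by
    have : (affineSpan F (A' : Set (Fin n → F)) : Set (Fin n → F)) =
        Set.range fun w : W => x + (w : Fin n → F) := by
      ext y
      rw [SetLike.mem_coe, hmem]
      exact ⟨fun h => ⟨⟨_, h⟩, by simp⟩, by rintro ⟨w, rfl⟩; simp⟩
    rw [this, Set.ncard_range_of_injective fun v w h => Subtype.ext (add_left_cancel h),
      Nat.card_eq_fintype_card]
  refine ⟨A', hsub, hne, ?_, ?_, ?_⟩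
  · rw [hncard]
    exact (div_le_div_iff₀ hq0 hW0).mp hdens
  · rw [hdir]
    have h1 : Real.log (A'.card / Fintype.card W) ≤ 0 := by
      refine Real.log_nonpos (by positivity) ((div_le_one hW0).mpr ?_)
      rw [hcardB]
      exact_mod_cast B.card_le_univ
    have h2 : -d * Real.log 2 ≤ Real.log (A.card / (Fintype.card F : ℝ) ^ n) := by
      rw [← Real.log_rpow two_pos]
      exact Real.log_le_log (by positivity) hdensA
    have h3 : θ * (n - Module.finrank F W) ≤ d := by nlinarith
    calc (n : ℝ) - Module.finrank F W ≤ d / θ := by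
          rw [le_div_iff₀ hθ0]
          linarith
      _ = C / t * d ^ 5 * k ^ 4 := by
          rw [hθ, hK]
          field_simp
  · have hS : ∀ y, y ∈ (affineSpan F (A' : Set (Fin n → F)) : Set (Fin n → F)) +
        (affineSpan F (A' : Set (Fin n → F)) : Set (Fin n → F)) ↔ y - (x + x) ∈ W := by
      intro y
      constructor
      · rintro ⟨a, ha, b, hb, rfl⟩
        have := W.add_mem ((hmem a).mp ha) ((hmem b).mp hb)
        rwa [sub_add_sub_comm] at this
      · intro h
        refine ⟨x, (hmem x).mpr (by simp), y - x, (hmem _).mpr ?_, add_sub_cancel _ _⟩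
        rwa [sub_sub]
    rw [kNormDivergence_cosetSlice A x W hB hS hk]
    by_contra! hlt
    have hsum0 : 0 ≤ ∑ w, |Fintype.card W * selfConv (ind B) w / (B.card : ℝ) ^ 2 - 1| ^ k :=
      Finset.sum_nonneg fun w _ => Real.rpow_nonneg (abs_nonneg _) k
    have hbig : ε ^ k * Fintype.card W <
        ∑ w, |Fintype.card W * selfConv (ind B) w / (B.card : ℝ) ^ 2 - 1| ^ k := by
      have h1 := Real.rpow_lt_rpow hε.le hlt (show 0 < k by linarith)
      rwa [← Real.rpow_mul (by positivity), one_div_mul_cancel (by linarith), Real.rpow_one,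
        lt_div_iff₀ hW0] at h1
    have hBd : (2 : ℝ) ^ (-d) * Fintype.card W ≤ B.card := by
      rw [← le_div_iff₀ hW0, ← hcardB]
      exact hdensA.trans hdens
    obtain ⟨V, E, w, hE, hVdim, hinc⟩ := hC F W k hk d hd B hBd hbig
    obtain ⟨hne', hlt'⟩ := sliceScore_lt_of_density_increment hB
      (Finset.card_pos.mp (hcardB ▸ hne.card_pos)) hcardB hE (by positivity) hθ0.le hVdim
      (by rw [hθK]; exact Real.log_lt_log (by linarith) (by linarith)) hinc
    exact (hmax _ _ hne').not_gt hlt'
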